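/- Assume n = 3 and (H1)-(H2), with compact global attractor Γ. Then the topological (cover) entropy of the time-one map Φ₁ restricted to the invariant compact set Γ equals 0. -/

import Mathlib

open Set Metric Filter Topology Pointwise

noncomputable section

abbrev Euc (n : ℕ) := EuclideanSpace ℝ (Fin n)

/-- `Φ` is a continuous flow on `ℝⁿ`. -/
def IsFlow {n : ℕ} (Φ : ℝ → Euc n → Euc n) : Prop :=
  Continuous (fun p : ℝ × Euc n => Φ p.1 p.2) ∧
  (∀ x, Φ 0 x = x) ∧
  (∀ t s x, Φ t (Φ s x) = Φ (t + s) x)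

/-- `Cp` is a closed, solid, salient convex cone. -/
def IsConeOrder {n : ℕ} (Cp : Set (Euc n)) : Prop :=
  IsClosed Cp ∧ (∀ x ∈ Cp, ∀ y ∈ Cp, x + y ∈ Cp) ∧
  (∀ α : ℝ, 0 < α → ∀ x ∈ Cp, α • x ∈ Cp) ∧
  (interior Cp).Nonempty ∧ Cp ∩ (-Cp) = {0}

/-- `x ≤ y` iff `y - x ∈ C⁺`. -/
def coneLe {n : ℕ} (Cp : Set (Euc n)) (x y : Euc n) : Prop := y - x ∈ Cp

/-- `x < y` iff `y - x ∈ C⁺ \ {0}`. -/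
def coneLt {n : ℕ} (Cp : Set (Euc n)) (x y : Euc n) : Prop := y - x ∈ Cp ∧ y ≠ x

/-- `x ≪ y` iff `y - x ∈ Int C⁺`. -/
def coneLL {n : ℕ} (Cp : Set (Euc n)) (x y : Euc n) : Prop := y - x ∈ interior Cp

/-- `S` is unordered: no two distinct points related by `≤`. -/
def Unordered {n : ℕ} (Cp : Set (Euc n)) (S : Set (Euc n)) : Prop :=
  ∀ x ∈ S, ∀ y ∈ S, x ≠ y → ¬ coneLe Cp x y

/-- (H1): `Φ` is strongly competitive. -/
def StronglyCompetitive {n : ℕ} (Φ : ℝ → Euc n → Euc n) (Cp : Set (Euc n)) : Prop :=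
  ∀ t : ℝ, 0 < t → ∀ x y : Euc n,
    (coneLe Cp (Φ t x) (Φ t y) → coneLe Cp x y) ∧
    (coneLt Cp (Φ t x) (Φ t y) → coneLL Cp x y)

/-- `D` is invariant under the flow. -/
def Invariant {n : ℕ} (Φ : ℝ → Euc n → Euc n) (D : Set (Euc n)) : Prop :=
  ∀ t : ℝ, Φ t '' D = D

/-- (H2): `Γ` is a compact invariant attractor uniformly attracting all compact sets. -/
def Dissipative {n : ℕ} (Φ : ℝ → Euc n → Euc n) (Γ : Set (Euc n)) : Prop :=
  Γ.Nonempty ∧ IsCompact Γ ∧ Invariant Φ Γ ∧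
  ∀ N : Set (Euc n), IsCompact N → ∀ ε > 0, ∃ T : ℝ, ∀ t ≥ T, ∀ x ∈ N,
    Metric.infDist (Φ t x) Γ < ε

/-- The ω-limit set of `x`. -/
def omegaSet {n : ℕ} (Φ : ℝ → Euc n → Euc n) (x : Euc n) : Set (Euc n) :=
  ⋂ t ∈ Ici (0 : ℝ), closure ((fun τ => Φ τ x) '' Ici t)

/-- The α-limit set of `x`. -/
def alphaSet {n : ℕ} (Φ : ℝ → Euc n → Euc n) (x : Euc n) : Set (Euc n) :=
  ⋂ t ∈ Iic (0 : ℝ), closure ((fun τ => Φ τ x) '' Iic t)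

/-- The set `R(Φ)` of recurrent points. -/
def recurrentSet {n : ℕ} (Φ : ℝ → Euc n → Euc n) : Set (Euc n) :=
  {x | x ∈ omegaSet Φ x}

/-- The Birkhoff center `𝓑(Φ)`. -/
def birkhoffCenter {n : ℕ} (Φ : ℝ → Euc n → Euc n) : Set (Euc n) :=
  closure (recurrentSet Φ)

/-- The set `E` of equilibria. -/
def equilibria {n : ℕ} (Φ : ℝ → Euc n → Euc n) : Set (Euc n) :=
  {p | ∀ t : ℝ, Φ t p = p}

/-- `C = C⁺ ∪ (−C⁺)`. -/
def coneC {n : ℕ} (Cp : Set (Euc n)) : Set (Euc n) := Cp ∪ (-Cp)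

/-- `K = closure(ℝⁿ \ C)`. -/
def coneK {n : ℕ} (Cp : Set (Euc n)) : Set (Euc n) := closure ((coneC Cp)ᶜ)

/-- The translated cone `C_x = x + C`. -/
def coneCAt {n : ℕ} (Cp : Set (Euc n)) (x : Euc n) : Set (Euc n) := {y | y - x ∈ coneC Cp}

/-- The translated complementary cone `K_x = x + K`. -/
def coneKAt {n : ℕ} (Cp : Set (Euc n)) (x : Euc n) : Set (Euc n) := {y | y - x ∈ coneK Cp}

/-- The increment over `[a, b]` of a continuous branch of the argument of `f`. -/
def argInc (f : ℝ → ℂ) (a b : ℝ) : ℝ :=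
  open Classical in
  if h : ∃ L : ℝ → ℂ, ContinuousOn L (Icc a b) ∧ ∀ t ∈ Icc a b, Complex.exp (L t) = f t then
    (h.choose b - h.choose a).im
  else 0

lemma argInc_eq_of_exp_eq {f L : ℝ → ℂ} {a b : ℝ} (hab : a ≤ b)
    (hL : ContinuousOn L (Icc a b)) (hf : ∀ t ∈ Icc a b, Complex.exp (L t) = f t) :
    argInc f a b = (L b - L a).im := by
  have h : ∃ L : ℝ → ℂ, ContinuousOn L (Icc a b) ∧ ∀ t ∈ Icc a b, Complex.exp (L t) = f t :=
    ⟨L, hL, hf⟩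
  rw [argInc, dif_pos h]
  obtain ⟨hM, hMf⟩ := h.choose_spec
  set M := h.choose
  have h_int : ∀ t ∈ Icc a b, ∃ n : ℤ, M t = L t + n * (2 * Real.pi * Complex.I) := fun t ht =>
    Complex.exp_eq_exp_iff_exists_int.1 ((hMf t ht).trans (hf t ht).symm)
  have hconst : M b - L b = M a - L a := by
    let g : ℝ → ℝ := fun t => (M t - L t).im / (2 * Real.pi)
    have hg : ContinuousOn g (Icc a b) := by
      apply ContinuousOn.div_const
      exact Complex.continuous_im.comp_continuousOn (hM.sub hL)
    have hmaps : MapsTo g (Icc a b) (range ((↑) : ℤ → ℝ)) := by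
      intro t ht
      obtain ⟨n, hn⟩ := h_int t ht
      refine ⟨n, ?_⟩
      simp only [g, hn]
      have : Real.pi ≠ 0 := Real.pi_ne_zero
      simp
    have hdisc : IsTotallyDisconnected (range ((↑) : ℤ → ℝ)) :=
      (countable_range _).isTotallyDisconnected
    have hsub : (g '' Icc a b).Subsingleton :=
      hdisc _ hmaps.image_subset (isPreconnected_Icc.image g hg)
    have hgab : g b = g a :=
      hsub (mem_image_of_mem g (right_mem_Icc.2 hab)) (mem_image_of_mem g (left_mem_Icc.2 hab))
    obtain ⟨n, hn⟩ := h_int b (right_mem_Icc.2 hab)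
    obtain ⟨m, hm⟩ := h_int a (left_mem_Icc.2 hab)
    have hpi : Real.pi ≠ 0 := Real.pi_ne_zero
    simp only [g, hn, hm] at hgab
    simp at hgab
    rw [hn, hm, hgab]; ring
  have : M b - M a = L b - L a := by linear_combination hconst
  rw [this]

lemma exists_log_rect {F : ℝ → ℝ → ℂ} {a b c d : ℝ} (hab : a ≤ b) (hcd : c ≤ d)
    (hF : ContinuousOn (fun z : ℝ × ℝ => F z.1 z.2) (Icc a b ×ˢ Icc c d))
    (h0 : ∀ r ∈ Icc a b, ∀ s ∈ Icc c d, F r s ≠ 0) :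
    ∃ L : ℝ → ℝ → ℂ, Continuous (fun z : ℝ × ℝ => L z.1 z.2) ∧
      ∀ r ∈ Icc a b, ∀ s ∈ Icc c d, Complex.exp (L r s) = F r s := by
  let G : ℝ × ℝ → ℂ := fun z => F (projIcc a b hab z.1) (projIcc c d hcd z.2)
  have hG : Continuous G := by
    have : Continuous fun z : ℝ × ℝ =>
        ((projIcc a b hab z.1 : ℝ), (projIcc c d hcd z.2 : ℝ)) := by
      exact ((continuous_subtype_val.comp continuous_projIcc).comp continuous_fst).prodMk
        ((continuous_subtype_val.comp continuous_projIcc).comp continuous_snd)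
    exact hF.comp_continuous this fun z => ⟨(projIcc a b hab z.1).2, (projIcc c d hcd z.2).2⟩
  have hG0 : (0 : ℂ) ∉ G '' univ := by
    rintro ⟨z, -, hz⟩
    exact h0 _ (projIcc a b hab z.1).2 _ (projIcc c d hcd z.2).2 hz
  have hsc : IsSimplyConnected (univ : Set (ℝ × ℝ)) := by
    have : ContractibleSpace (univ : Set (ℝ × ℝ)) :=
      convex_univ.contractibleSpace univ_nonempty
    exact SimplyConnectedSpace.ofContractible _
  obtain ⟨L, hL, hLG⟩ := Complex.exists_continuousOn_eqOn_exp_comp hsc isOpen_univ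
    hG.continuousOn hG0
  refine ⟨fun r s => L (r, s), by simpa using continuousOn_univ.1 hL, fun r hr s hs => ?_⟩
  have := hLG (mem_univ (r, s))
  simpa [G, projIcc_of_mem hab hr, projIcc_of_mem hcd hs] using this

lemma exists_log_Icc {f : ℝ → ℂ} {a b : ℝ} (hab : a ≤ b) (hf : ContinuousOn f (Icc a b))
    (h0 : ∀ r ∈ Icc a b, f r ≠ 0) :
    ∃ L : ℝ → ℂ, Continuous L ∧ ∀ r ∈ Icc a b, Complex.exp (L r) = f r := by
  obtain ⟨L, hL, hLf⟩ := exists_log_rect (F := fun r _ => f r) hab (le_refl (0 : ℝ))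
    (hf.comp continuousOn_fst fun z hz => hz.1) (fun r hr _ _ => h0 r hr)
  exact ⟨fun r => L r 0, hL.comp (Continuous.prodMk_left 0),
    fun r hr => hLf r hr 0 (by simp)⟩

lemma argInc_add {f : ℝ → ℂ} {a b c : ℝ} (hab : a ≤ b) (hbc : b ≤ c)
    (hf : ContinuousOn f (Icc a c)) (h0 : ∀ r ∈ Icc a c, f r ≠ 0) :
    argInc f a c = argInc f a b + argInc f b c := by
  obtain ⟨L, hL, hLf⟩ := exists_log_Icc (hab.trans hbc) hf h0
  rw [argInc_eq_of_exp_eq (hab.trans hbc) hL.continuousOn hLf,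
    argInc_eq_of_exp_eq hab hL.continuousOn fun t ht => hLf t ⟨ht.1, ht.2.trans hbc⟩,
    argInc_eq_of_exp_eq hbc hL.continuousOn fun t ht => hLf t ⟨hab.trans ht.1, ht.2⟩]
  simp

lemma argInc_rect {F : ℝ → ℝ → ℂ} {a b c d : ℝ} (hab : a ≤ b) (hcd : c ≤ d)
    (hF : ContinuousOn (fun z : ℝ × ℝ => F z.1 z.2) (Icc a b ×ˢ Icc c d))
    (h0 : ∀ r ∈ Icc a b, ∀ s ∈ Icc c d, F r s ≠ 0) :
    argInc (fun r => F r c) a b - argInc (fun r => F r d) a b =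
      argInc (F a) c d - argInc (F b) c d := by
  obtain ⟨L, hL, hLF⟩ := exists_log_rect hab hcd hF h0
  have h1 : ∀ s ∈ Icc c d, argInc (fun r => F r s) a b = (L b s - L a s).im := fun s hs =>
    argInc_eq_of_exp_eq (L := fun r => L r s) hab
      (hL.comp (Continuous.prodMk_left s)).continuousOn fun t ht => hLF t ht s hs
  have h2 : ∀ r ∈ Icc a b, argInc (F r) c d = (L r d - L r c).im := fun r hr =>
    argInc_eq_of_exp_eq (L := L r) hcd
      (hL.comp (Continuous.prodMk_right r)).continuousOn fun t ht => hLF r hr t ht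
  rw [h1 c (left_mem_Icc.2 hcd), h1 d (right_mem_Icc.2 hcd), h2 a (left_mem_Icc.2 hab),
    h2 b (right_mem_Icc.2 hab)]
  simp only [Complex.sub_im]
  ring

lemma argInc_neg {f : ℝ → ℂ} {a b : ℝ} (hab : a ≤ b) (hf : ContinuousOn f (Icc a b))
    (h0 : ∀ r ∈ Icc a b, f r ≠ 0) :
    argInc (fun r => -f r) a b = argInc f a b := by
  obtain ⟨L, hL, hLf⟩ := exists_log_Icc hab hf h0
  rw [argInc_eq_of_exp_eq hab hL.continuousOn hLf,
    argInc_eq_of_exp_eq (L := fun t => L t + Real.pi * Complex.I) hab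
      (hL.add continuous_const).continuousOn fun t ht => ?_]
  · simp
  · rw [Complex.exp_add, hLf t ht, Complex.exp_pi_mul_I]; ring

lemma argInc_comp_add {f : ℝ → ℂ} {a b : ℝ} (e : ℝ) (hab : a ≤ b)
    (hf : ContinuousOn f (Icc (a + e) (b + e))) (h0 : ∀ r ∈ Icc (a + e) (b + e), f r ≠ 0) :
    argInc (fun r => f (r + e)) a b = argInc f (a + e) (b + e) := by
  obtain ⟨L, hL, hLf⟩ := exists_log_Icc (by linarith) hf h0
  rw [argInc_eq_of_exp_eq (by linarith) hL.continuousOn hLf,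
    argInc_eq_of_exp_eq (L := fun t => L (t + e)) hab
      (hL.comp (continuous_add_const e)).continuousOn
      fun t ht => hLf _ ⟨by linarith [ht.1], by linarith [ht.2]⟩]

lemma abs_argInc_sub_le {f g : ℝ → ℂ} {a b : ℝ} (hab : a ≤ b) (hf : ContinuousOn f (Icc a b))
    (hg : ContinuousOn g (Icc a b)) (h0 : ∀ r ∈ Icc a b, g r ≠ 0)
    (hfg : ∀ r ∈ Icc a b, ‖f r - g r‖ ≤ ‖g r‖ / 100) :
    |argInc f a b - argInc g a b| ≤ 3 / 100 := by
  obtain ⟨L, hL, hLg⟩ := exists_log_Icc hab hg h0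
  let z : ℝ → ℂ := fun t => (f t - g t) / g t
  have hz : ∀ t ∈ Icc a b, ‖z t‖ ≤ 1 / 100 := fun t ht => by
    have := norm_pos_iff.2 (h0 t ht)
    rw [norm_div, div_le_iff₀ this]
    linarith [hfg t ht]
  have hslit : ∀ t ∈ Icc a b, 1 + z t ∈ Complex.slitPlane := fun t ht =>
    Complex.mem_slitPlane_of_norm_lt_one ((hz t ht).trans_lt (by norm_num))
  have hzc : ContinuousOn z (Icc a b) := (hf.sub hg).div hg h0
  have hlog : ContinuousOn (fun t => Complex.log (1 + z t)) (Icc a b) :=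
    (continuousOn_const.add hzc).clog hslit
  rw [argInc_eq_of_exp_eq hab hL.continuousOn hLg,
    argInc_eq_of_exp_eq (L := fun t => L t + Complex.log (1 + z t)) hab
      (hL.continuousOn.add hlog) fun t ht => ?_]
  · have hsmall : ∀ t ∈ Icc a b, |(Complex.log (1 + z t)).im| ≤ 3 / 200 := fun t ht => by
      refine (Complex.abs_im_le_norm _).trans
        ((Complex.norm_log_one_add_half_le_self ((hz t ht).trans (by norm_num))).trans ?_)
      linarith [hz t ht]
    have h1 := hsmall a (left_mem_Icc.2 hab)
    have h2 := hsmall b (right_mem_Icc.2 hab)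
    rw [abs_le] at *
    simp only [Complex.sub_im, Complex.add_im]
    constructor <;> linarith
  · rw [Complex.exp_add, hLg t ht, Complex.exp_log (Complex.slitPlane_ne_zero (hslit t ht))]
    simp only [z]
    field_simp [h0 t ht]
    ring

lemma abs_argInc_le_of_near_const {f : ℝ → ℂ} {a b : ℝ} (hab : a ≤ b)
    (hf : ContinuousOn f (Icc a b)) {w : ℂ} (hw : w ≠ 0)
    (hfw : ∀ r ∈ Icc a b, ‖f r - w‖ ≤ ‖w‖ / 100) : |argInc f a b| ≤ 3 / 100 := by
  have h := abs_argInc_sub_le hab hf (continuousOn_const (c := w)) (fun _ _ => hw) hfw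
  have h0 : argInc (fun _ => w) a b = 0 := by
    rw [argInc_eq_of_exp_eq (L := fun _ => Complex.log w) hab continuousOn_const
      fun _ _ => Complex.exp_log hw]
    simp
  rwa [h0, sub_zero] at h

lemma norm_mul_exp_argInc {f : ℝ → ℂ} {a b : ℝ} (hab : a ≤ b) (hf : ContinuousOn f (Icc a b))
    (h0 : ∀ r ∈ Icc a b, f r ≠ 0) :
    ∃ c : ℝ, 0 < c ∧ f b = c * (f a * Complex.exp (argInc f a b * Complex.I)) := by
  obtain ⟨L, hL, hLf⟩ := exists_log_Icc hab hf h0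
  refine ⟨Real.exp (L b - L a).re, Real.exp_pos _, ?_⟩
  rw [argInc_eq_of_exp_eq hab hL.continuousOn hLf, ← hLf b (right_mem_Icc.2 hab),
    ← hLf a (left_mem_Icc.2 hab), Complex.ofReal_exp, ← Complex.exp_add, ← Complex.exp_add]
  congr 1
  have := Complex.re_add_im (L b - L a)
  linear_combination (-1 : ℂ) * this

/-- The argument increments of a curve about two points of a path-connected set which it
avoids are close if the set is small as seen from the end points of the curve. -/
lemma abs_argInc_sub_le_of_isPathConnected {K : Set ℂ} (hK : IsPathConnected K) {p q : ℂ}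
    (hp : p ∈ K) (hq : q ∈ K) {c : ℝ → ℂ} {a b : ℝ} (hab : a ≤ b)
    (hc : ContinuousOn c (Icc a b)) (hcK : ∀ t ∈ Icc a b, c t ∉ K) {v w : ℂ} (hv : v ≠ 0)
    (hw : w ≠ 0) (hva : ∀ k ∈ K, ‖c a - k - v‖ ≤ ‖v‖ / 100)
    (hwb : ∀ k ∈ K, ‖c b - k - w‖ ≤ ‖w‖ / 100) :
    |argInc (fun t => c t - p) a b - argInc (fun t => c t - q) a b| ≤ 6 / 100 := by
  obtain ⟨σ, hσ⟩ := hK.joinedIn p hp q hq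
  have hσK : ∀ u, σ.extend u ∈ K := fun u => by
    have : σ.extend u ∈ range σ := σ.extend_range ▸ mem_range_self u
    obtain ⟨v, hv⟩ := this
    exact hv ▸ hσ v
  have hcont : Continuous σ.extend := σ.continuous_extend
  have := argInc_rect (F := fun r u => c r - σ.extend u) hab (zero_le_one' ℝ)
    ((hc.comp continuousOn_fst fun z hz => hz.1).sub
      (hcont.comp continuous_snd).continuousOn)
    (fun r hr s _ h => hcK r hr (by rw [sub_eq_zero.1 h]; exact hσK s))
  simp only [Path.extend_zero, Path.extend_one] at this
  rw [this]
  have h1 := abs_argInc_le_of_near_const (f := fun u => c a - σ.extend u) (zero_le_one' ℝ)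
    (by fun_prop) hv fun r _ => hva _ (hσK r)
  have h2 := abs_argInc_le_of_near_const (f := fun u => c b - σ.extend u) (zero_le_one' ℝ)
    (by fun_prop) hw fun r _ => hwb _ (hσK r)
  refine (abs_sub _ _).trans ?_
  linarith

lemma argInc_sub_comm (f g : ℝ → ℂ) {a b : ℝ} (hab : a ≤ b) (hf : Continuous f)
    (hg : Continuous g) (h0 : ∀ r ∈ Icc a b, f r - g r ≠ 0) :
    argInc (fun r => f r - g r) a b = argInc (fun r => g r - f r) a b := by
  rw [← argInc_neg (f := fun r => f r - g r) hab (hf.sub hg).continuousOn h0]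
  simp only [neg_sub]
/-- On a preconnected space, a tournament whose initial and final segments are open
is transitive. -/
lemma trans_of_isOpen_segments {X : Type*} [TopologicalSpace X] [PreconnectedSpace X]
    {r : X → X → Prop} (hirr : ∀ a, ¬ r a a) (htot : ∀ a b, a ≠ b → (r a b ↔ ¬ r b a))
    (hl : ∀ b, IsOpen {a | r a b}) (hr : ∀ a, IsOpen {b | r a b}) {a b c : X}
    (hab : r a b) (hbc : r b c) : r a c := by
  by_contra hac
  have hane : a ≠ b := fun h => hirr b (h ▸ hab)
  have hca : r c a := by
    by_cases h : c = a
    · subst h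
      exact absurd hbc ((htot _ _ hane).1 hab)
    · exact (htot _ _ h).2 hac
  have hZ : {z | r z a} ∩ {z | r b z} = {z | r a z}ᶜ ∩ {z | r z b}ᶜ := by
    ext z
    simp only [mem_inter_iff, mem_ofPred_eq, mem_compl_iff]
    constructor
    · rintro ⟨h1, h2⟩
      have hza : z ≠ a := fun h => hirr a (h ▸ h1)
      have hzb : b ≠ z := fun h => hirr b (by rwa [← h] at h2)
      exact ⟨(htot _ _ hza).1 h1, (htot _ _ hzb).1 h2⟩
    · rintro ⟨h1, h2⟩
      have hza : z ≠ a := fun h => h2 (h ▸ hab)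
      have hzb : b ≠ z := fun h => h1 (h ▸ hab)
      exact ⟨(htot _ _ hza).2 h1, (htot _ _ hzb).2 h2⟩
  have hclopen : IsClopen ({z | r z a} ∩ {z | r b z}) := by
    refine ⟨?_, (hl a).inter (hr b)⟩
    rw [hZ]
    exact (hr a).isClosed_compl.inter (hl b).isClosed_compl
  have hne : ({z | r z a} ∩ {z | r b z}).Nonempty := ⟨c, hca, hbc⟩
  have huniv := (isClopen_iff.1 hclopen).resolve_left hne.ne_empty
  have : a ∈ {z | r z a} ∩ {z | r b z} := huniv ▸ mem_univ a
  exact hirr a this.1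

lemma not_recurrent_of_monotone {X : Type*} [TopologicalSpace X] [PreconnectedSpace X]
    {r : X → X → Prop} (hirr : ∀ a, ¬ r a a) (htot : ∀ a b, a ≠ b → (r a b ↔ ¬ r b a))
    (hl : ∀ b, IsOpen {a | r a b}) (hr : ∀ a, IsOpen {b | r a b}) {p : ℕ → X}
    (hp : ∀ n, r (p n) (p (n + 1))) : ¬ ∀ W ∈ 𝓝 (p 0), ∃ n ≥ 2, p n ∈ W := by
  intro hrec
  obtain ⟨n, hn, hnW⟩ := hrec _ ((hl (p 1)).mem_nhds (hp 0))
  have hmono : ∀ n ≥ 2, r (p 1) (p n) := by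
    intro n hn
    induction n, hn using Nat.le_induction with
    | base => exact hp 1
    | succ k _ ih => exact trans_of_isOpen_segments hirr htot hl hr ih (hp k)
  have h1 := hmono n hn
  have hne : p n ≠ p 1 := fun h => hirr (p 1) (by rwa [h] at h1)
  exact (htot _ _ hne).1 hnW h1
lemma exists_strictMonoOn_along_flow (φ : Flow ℝ ℂ) {x : ℂ} (hx : φ 1 x ≠ x) :
    ∃ g : ℂ → ℝ, Continuous g ∧ ∃ N ∈ 𝓝 x, ∃ δ > 0, ∀ p ∈ N,
      StrictMonoOn (fun t => g (φ t p)) (Icc (-δ) δ) := by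
  set u := φ 1 x - x with hu
  let g : ℂ → ℝ := fun p => ∫ s in (0 : ℝ)..1, inner ℝ u (φ s p)
  have hcont : Continuous fun z : ℂ × ℝ => inner ℝ u (φ z.2 z.1) :=
    continuous_const.inner (φ.continuous continuous_snd continuous_fst)
  have hg : Continuous g :=
    intervalIntegral.continuous_parametric_intervalIntegral_of_continuous' hcont 0 1
  have hflow : ∀ p, Continuous fun t => inner ℝ u (φ t p) := fun p =>
    hcont.comp (Continuous.prodMk_right p)
  have hshift : ∀ p t, g (φ t p) = (∫ s in (0 : ℝ)..(1 + t), inner ℝ u (φ s p)) -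
      ∫ s in (0 : ℝ)..t, inner ℝ u (φ s p) := fun p t => by
    have : g (φ t p) = ∫ s in (0 : ℝ)..1, inner ℝ u (φ (s + t) p) := by
      simp only [g, φ.map_add]
    rw [this, intervalIntegral.integral_comp_add_right (fun s => inner ℝ u (φ s p)),
      intervalIntegral.integral_interval_sub_left ((hflow p).intervalIntegrable _ _)
      ((hflow p).intervalIntegrable _ _), zero_add]
  have hderiv : ∀ p t, HasDerivAt (fun t => g (φ t p))
      (inner ℝ u (φ (1 + t) p) - inner ℝ u (φ t p)) t := fun p t => by
    have h1 : ∀ t, HasDerivAt (fun t => ∫ s in (0 : ℝ)..t, inner ℝ u (φ s p))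
        (inner ℝ u (φ t p)) t := fun t =>
      intervalIntegral.integral_hasDerivAt_right ((hflow p).intervalIntegrable _ _)
        (hflow p).stronglyMeasurable.stronglyMeasurableAtFilter (hflow p).continuousAt
    have := ((h1 (1 + t)).comp_const_add 1 t).sub (h1 t)
    exact this.congr_of_eventuallyEq (Eventually.of_forall fun s => hshift p s)
  refine ⟨g, hg, ?_⟩
  have hpos : ∀ᶠ z : ℂ × ℝ in 𝓝 (x, 0), 0 < inner ℝ u (φ (1 + z.2) z.1) - inner ℝ u (φ z.2 z.1) := by
    have hc : Continuous fun z : ℂ × ℝ =>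
        inner ℝ u (φ (1 + z.2) z.1) - inner ℝ u (φ z.2 z.1) :=
      (continuous_const.inner (φ.continuous (continuous_const.add continuous_snd)
        continuous_fst)).sub hcont
    refine hc.continuousAt.eventually (lt_mem_nhds ?_)
    simp only [add_zero, φ.map_zero_apply, ← inner_sub_right]
    rw [← hu]
    exact real_inner_self_pos.2 (sub_ne_zero.2 hx)
  rw [nhds_prod_eq] at hpos
  obtain ⟨N, hN, U, hU, hNU⟩ := mem_prod_iff.1 hpos
  obtain ⟨δ, hδ, hδU⟩ := nhds_basis_closedBall.mem_iff.1 hU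
  refine ⟨N, hN, δ, hδ, fun p hp => ?_⟩
  refine strictMonoOn_of_deriv_pos (convex_Icc _ _)
    (fun t _ => (hderiv p t).continuousAt.continuousWithinAt) fun t ht => ?_
  rw [(hderiv p t).deriv]
  rw [interior_Icc] at ht
  exact hNU (mk_mem_prod hp (hδU (by
    rw [mem_closedBall, Real.dist_eq, sub_zero, abs_le]; exact ⟨ht.1.le, ht.2.le⟩)))

/-- Local sections of a planar flow at a point moved by the time-one map. -/
lemma exists_local_section (φ : Flow ℝ ℂ) {x : ℂ} (hx : φ 1 x ≠ x) :
    ∃ δ > 0, ∀ V ∈ 𝓝 x, ∃ S ⊆ V, IsPathConnected S ∧ x ∈ S ∧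
      (∀ p ∈ S, ∀ t, t ≠ 0 → |t| ≤ 4 * δ → φ t p ∉ S) ∧
      ∀ W ∈ 𝓝 x, ∀ᶠ q in 𝓝 x, ∃ τ, |τ| ≤ 1 ∧ φ τ q ∈ S ∩ W := by
  obtain ⟨g, hg, N, hN, δ₀, hδ₀, hmono⟩ := exists_strictMonoOn_along_flow φ hx
  obtain ⟨δ, hδ, hδ1, hδδ₀⟩ : ∃ δ : ℝ, 0 < δ ∧ δ ≤ 1 ∧ δ ≤ δ₀ :=
    ⟨min 1 δ₀, lt_min one_pos hδ₀, min_le_left _ _, min_le_right _ _⟩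
  replace hmono : ∀ p ∈ N, StrictMonoOn (fun t => g (φ t p)) (Icc (-δ) δ) := fun p hp =>
    (hmono p hp).mono (Icc_subset_Icc (by linarith) hδδ₀)
  have hgt : ∀ t, Continuous fun p => g (φ t p) := fun t =>
    hg.comp (φ.continuous continuous_const continuous_id)
  have hgp : ∀ p, Continuous fun t => g (φ t p) := fun p =>
    hg.comp (φ.continuous continuous_id continuous_const)
  obtain ⟨B, hB, hBN⟩ : ∃ B > 0, ∀ p ∈ ball x B,
      p ∈ N ∧ g (φ (-δ) p) < g x ∧ g x < g (φ δ p) := by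
    have h0 : g (φ 0 x) = g x := by rw [φ.map_zero_apply]
    have hxN := mem_of_mem_nhds hN
    have h1 : g (φ (-δ) x) < g x := h0 ▸ hmono x hxN ⟨by linarith, by linarith⟩
      ⟨by linarith, by linarith⟩ (by linarith)
    have h2 : g x < g (φ δ x) := h0 ▸ hmono x hxN ⟨by linarith, by linarith⟩
      ⟨by linarith, by linarith⟩ (by linarith)
    have := Filter.Eventually.and hN (((hgt (-δ)).continuousAt.eventually (gt_mem_nhds h1)).and
      ((hgt δ).continuousAt.eventually (lt_mem_nhds h2)))
    exact Metric.eventually_nhds_iff_ball.1 this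
  have hex : ∀ p ∈ ball x B, ∃ t ∈ Ioo (-δ) δ, g (φ t p) = g x := fun p hp => by
    obtain ⟨-, h1, h2⟩ := hBN p hp
    exact intermediate_value_Ioo (by linarith) (hgp p).continuousOn ⟨h1, h2⟩
  choose! τ hτ hgτ using hex
  have hτc : ContinuousOn τ (ball x B) := by
    intro p hp
    refine ContinuousAt.continuousWithinAt ?_
    rw [ContinuousAt, tendsto_order]
    have hpN := (hBN p hp).1
    have hev : ∀ᶠ q in 𝓝 p, q ∈ ball x B := isOpen_ball.mem_nhds hp
    obtain ⟨hτ1, hτ2⟩ := hτ p hp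
    constructor
    · intro a ha
      set a' := max a (-δ) with ha'
      have haa : a' < τ p := max_lt ha hτ1
      have hlt : g (φ a' p) < g x := hgτ p hp ▸ hmono p hpN
        ⟨le_max_right _ _, by linarith⟩ ⟨hτ1.le, hτ2.le⟩ haa
      filter_upwards [hev, (hgt a').continuousAt.eventually (gt_mem_nhds hlt)] with q hq hqa
      refine (le_max_left a (-δ)).trans_lt ?_
      by_contra! hcon
      have := (hmono q (hBN q hq).1).monotoneOn ⟨(hτ q hq).1.le, (hτ q hq).2.le⟩
        ⟨le_max_right _ _, by linarith⟩ hcon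
      simp only [hgτ q hq] at this
      exact absurd hqa (not_lt.2 this)
    · intro a ha
      set a' := min a δ with ha'
      have haa : τ p < a' := lt_min ha hτ2
      have hlt : g x < g (φ a' p) := hgτ p hp ▸ hmono p hpN
        ⟨hτ1.le, hτ2.le⟩ ⟨by linarith, min_le_right _ _⟩ haa
      filter_upwards [hev, (hgt a').continuousAt.eventually (lt_mem_nhds hlt)] with q hq hqa
      refine LT.lt.trans_le ?_ (min_le_left a δ)
      by_contra! hcon
      have := (hmono q (hBN q hq).1).monotoneOn ⟨by linarith, min_le_right _ _⟩
        ⟨(hτ q hq).1.le, (hτ q hq).2.le⟩ hcon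
      simp only [hgτ q hq] at this
      exact absurd hqa (not_lt.2 this)
  have hxB : x ∈ ball x B := mem_ball_self hB
  have hτx : τ x = 0 := by
    refine (hmono x (hBN x hxB).1).injOn ⟨(hτ x hxB).1.le, (hτ x hxB).2.le⟩
      ⟨by linarith, hδ.le⟩ ?_
    simp only [hgτ x hxB, φ.map_zero_apply]
  let R : ℂ → ℂ := fun p => φ (τ p) p
  have hRc : ContinuousOn R (ball x B) :=
    (φ.cont').comp_continuousOn (hτc.prodMk continuousOn_id)
  have hRx : R x = x := by simp only [R, hτx, φ.map_zero_apply]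
  have hRx' : ContinuousAt R x := hRc.continuousAt (ball_mem_nhds x hB)
  refine ⟨δ / 4, by positivity, fun V hV => ?_⟩
  have hpre : R ⁻¹' (V ∩ N) ∈ 𝓝 x := hRx' (by rw [hRx]; exact inter_mem hV hN)
  obtain ⟨b, hb, hbV⟩ := Metric.mem_nhds_iff.1 (inter_mem hpre (ball_mem_nhds x hB))
  refine ⟨R '' ball x b, ?_, ?_, ⟨x, mem_ball_self hb, hRx⟩, ?_, ?_⟩
  · rintro _ ⟨p, hp, rfl⟩
    exact (hbV hp).1.1
  · exact ((convex_ball x b).isPathConnected ⟨x, mem_ball_self hb⟩).image'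
      (hRc.mono fun p hp => (hbV hp).2)
  · rintro _ ⟨p, hp, rfl⟩ t ht0 ht ⟨q, hq, hqp⟩
    have h4 : 4 * (δ / 4) = δ := by ring
    rw [h4, abs_le] at ht
    refine ht0 ((hmono (R p) (hbV hp).1.2).injOn ht ⟨by linarith, hδ.le⟩ ?_)
    simp only [φ.map_zero_apply]
    rw [← hqp]
    simp only [R, hgτ q (hbV hq).2, hgτ p (hbV hp).2]
  · intro W hW
    have hpre' : R ⁻¹' W ∈ 𝓝 x := hRx' (by rwa [hRx])
    filter_upwards [hpre', ball_mem_nhds x hb] with q hq hqb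
    have hqB := (hbV hqb).2
    exact ⟨τ q, abs_le.2 ⟨by linarith [(hτ q hqB).1], by linarith [(hτ q hqB).2]⟩,
      ⟨q, hqb, rfl⟩, hq⟩
/-- A small local section of a planar flow at `x`, on whose time-`4δ` flow box the flow is
`ρ`-close to the orbit of `x`. -/
structure IsSmallSection (φ : Flow ℝ ℂ) (x : ℂ) (δ ρ : ℝ) (S : Set ℂ) : Prop where
  delta_pos : 0 < δ
  rho_pos : 0 < ρ
  isPathConnected : IsPathConnected S
  mem : x ∈ S
  notMem : ∀ p ∈ S, ∀ t, t ≠ 0 → |t| ≤ 4 * δ → φ t p ∉ S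
  close : ∀ p ∈ S, ∀ t, |t| ≤ 4 * δ → ‖φ t p - φ t x‖ ≤ ρ
  far : ∀ t s, |t| ≤ 4 * δ → |s| ≤ 4 * δ → δ ≤ |t - s| → 1000 * ρ ≤ ‖φ t x - φ s x‖

/-- The rotation of the orbit segment of `q` about `p`. -/
def sectionAngle (φ : Flow ℝ ℂ) (δ : ℝ) (p q : ℂ) : ℝ :=
  argInc (fun r => φ r q - p) (-δ) δ

/-- Half a turn away from the angle by which orbit segments turn about points of a section. -/
def refAngle (φ : Flow ℝ ℂ) (δ : ℝ) (x : ℂ) : ℝ :=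
  argInc (fun r => φ r x - φ (-δ) x) 0 δ + argInc (fun s => φ δ x - φ s x) (-δ) 0

lemma Flow.continuous_time {X : Type*} [TopologicalSpace X] (φ : Flow ℝ X) (p : X) :
    Continuous fun t => φ t p := φ.continuous continuous_id continuous_const

lemma Flow.eq_of_map_eq {X : Type*} [TopologicalSpace X] (φ : Flow ℝ X) {t s : ℝ} {p q : X}
    (h : φ t p = φ s q) : φ (t - s) p = q := by
  rw [sub_eq_neg_add, φ.map_add, h, ← φ.map_add, neg_add_cancel, φ.map_zero_apply]

lemma pi_half_le_abs_of_opposite {w₀ w₁ z₀ z₁ : ℂ} {κ ν c d : ℝ} (hw₀ : w₀ ≠ 0) (hw₁ : w₁ ≠ 0)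
    (hc : 0 < c) (hd : 0 < d) (hw : w₁ = c * (w₀ * Complex.exp (κ * Complex.I)))
    (hz : z₁ = d * (z₀ * Complex.exp (ν * Complex.I)))
    (h₀ : ‖z₀ + w₀‖ ≤ ‖w₀‖ / 100) (h₁ : ‖z₁ - w₁‖ ≤ ‖w₁‖ / 100) : 1.57 ≤ |ν - κ| := by
  by_contra! hlt
  have hn0 := norm_pos_iff.2 hw₀
  have hn1 := norm_pos_iff.2 hw₁
  obtain ⟨a, ha⟩ : ∃ a, a = z₀ / (-w₀) := ⟨_, rfl⟩
  obtain ⟨b, hb⟩ : ∃ b, b = z₁ / w₁ := ⟨_, rfl⟩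
  have ha1 : ‖a - 1‖ ≤ 1 / 100 := by
    have : a - 1 = (z₀ + w₀) / (-w₀) := by rw [ha]; field_simp; ring
    rw [this, norm_div, norm_neg, div_le_iff₀ hn0]
    linarith
  have hb1 : ‖b - 1‖ ≤ 1 / 100 := by
    have : b - 1 = (z₁ - w₁) / w₁ := by rw [hb]; field_simp
    rw [this, norm_div, div_le_iff₀ hn1]
    linarith
  have hba : b = -((d / c : ℝ) * (a * Complex.exp ((ν - κ : ℝ) * Complex.I))) := by
    have hcc : (c : ℂ) ≠ 0 := by exact_mod_cast hc.ne'
    have he : Complex.exp (κ * Complex.I) ≠ 0 := Complex.exp_ne_zero _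
    rw [hb, ha, hz, hw]
    push_cast
    rw [sub_mul, Complex.exp_sub]
    field_simp
  have ha0 : 99 / 100 ≤ ‖a‖ := by
    have h := norm_sub_norm_le (1 : ℂ) (1 - a)
    rw [sub_sub_cancel, norm_one, norm_sub_rev] at h
    linarith
  have hane : a ≠ 0 := norm_pos_iff.1 (by linarith)
  have hq : ‖b / a - 1‖ < 1 := by
    have : b / a - 1 = ((b - 1) - (a - 1)) / a := by field_simp; ring
    rw [this, norm_div, div_lt_one (by linarith)]
    linarith [norm_sub_le (b - 1) (a - 1)]
  have hre : 0 < (b / a).re := by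
    have h := (Complex.abs_re_le_norm (b / a - 1)).trans_lt hq
    rw [Complex.sub_re, Complex.one_re, abs_lt] at h
    linarith
  have hre' : (b / a).re = -(d / c * Real.cos (ν - κ)) := by
    have : b / a = -((d / c : ℝ) * Complex.exp ((ν - κ : ℝ) * Complex.I)) := by
      rw [hba]; field_simp
    rw [this, Complex.neg_re, Complex.re_ofReal_mul, Complex.exp_ofReal_mul_I_re]
  have hcos : 0 < Real.cos (ν - κ) := by
    have hpi := Real.pi_gt_d2
    rw [abs_lt] at hlt
    exact Real.cos_pos_of_mem_Ioo ⟨by linarith, by linarith⟩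
  have : 0 < d / c * Real.cos (ν - κ) := by positivity
  linarith

namespace IsSmallSection

variable {φ : Flow ℝ ℂ} {x : ℂ} {δ ρ : ℝ} {S : Set ℂ}

lemma map_ne (h : IsSmallSection φ x δ ρ S) {p q : ℂ} (hp : p ∈ S) (hq : q ∈ S) (hpq : p ≠ q)
    {t s : ℝ} (hts : |t - s| ≤ 4 * δ) : φ t q - φ s p ≠ 0 := by
  intro h0
  have h1 := φ.eq_of_map_eq (sub_eq_zero.1 h0)
  by_cases ht : t - s = 0
  · rw [ht, φ.map_zero_apply] at h1
    exact hpq h1.symm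
  · exact h.notMem q hq _ ht hts (h1 ▸ hp)

lemma orbit_ne (h : IsSmallSection φ x δ ρ S) {t s : ℝ} (ht : |t| ≤ 4 * δ) (hs : |s| ≤ 4 * δ)
    (hts : δ ≤ |t - s|) : φ t x - φ s x ≠ 0 :=
  norm_pos_iff.1 (by linarith [h.far t s ht hs hts, h.rho_pos])

lemma norm_sub_sub_le (h : IsSmallSection φ x δ ρ S) {p q : ℂ} (hp : p ∈ S) (hq : q ∈ S)
    {t s : ℝ} (ht : |t| ≤ 4 * δ) (hs : |s| ≤ 4 * δ) (hts : δ ≤ |t - s|) :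
    ‖(φ t q - φ s p) - (φ t x - φ s x)‖ ≤ ‖φ t x - φ s x‖ / 100 := by
  have h1 := h.close q hq t ht
  have h2 := h.close p hp s hs
  have h3 := h.far t s ht hs hts
  have : (φ t q - φ s p) - (φ t x - φ s x) = (φ t q - φ t x) - (φ s p - φ s x) := by ring
  rw [this]
  linarith [norm_sub_le (φ t q - φ t x) (φ s p - φ s x), h.rho_pos]

lemma abs_sectionAngle_sub_refAngle (h : IsSmallSection φ x δ ρ S) {p q : ℂ} (hp : p ∈ S)
    (hq : q ∈ S) (hpq : p ≠ q) : 1.57 ≤ |sectionAngle φ δ p q - refAngle φ δ x| := by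
  have hδ := h.delta_pos
  have a0 : |(0 : ℝ)| ≤ 4 * δ := by rw [abs_zero]; positivity
  have a1 : |δ| ≤ 4 * δ := by rw [abs_of_pos hδ]; linarith
  have a2 : |-δ| ≤ 4 * δ := by rwa [abs_neg]
  have b1 : δ ≤ |δ - 0| := by rw [sub_zero]; exact le_abs_self δ
  have b2 : δ ≤ |-δ - 0| := by rw [sub_zero, abs_neg]; exact le_abs_self δ
  have b3 : δ ≤ |0 - -δ| := by rw [abs_sub_comm]; exact b2
  have hcx := φ.continuous_time x
  obtain ⟨c1, hc1, e1⟩ := norm_mul_exp_argInc (f := fun r => φ r x - φ (-δ) x) hδ.le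
    (hcx.sub continuous_const).continuousOn fun r hr => h.orbit_ne
      (abs_le.2 ⟨by linarith [hr.1], by linarith [hr.2]⟩) a2
      (by rw [abs_of_nonneg] <;> linarith [hr.1])
  obtain ⟨c2, hc2, e2⟩ := norm_mul_exp_argInc (f := fun s => φ δ x - φ s x) (neg_nonpos.2 hδ.le)
    (continuous_const.sub hcx).continuousOn fun r hr => h.orbit_ne a1
      (abs_le.2 ⟨by linarith [hr.1], by linarith [hr.2]⟩)
      (by rw [abs_of_nonneg] <;> linarith [hr.2])
  obtain ⟨d, hd, e3⟩ := norm_mul_exp_argInc (f := fun r => φ r q - p) (by linarith : -δ ≤ δ)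
    ((φ.continuous_time q).sub continuous_const).continuousOn fun r hr => by
      have := h.map_ne hp hq hpq (t := r) (s := 0)
        (abs_le.2 ⟨by linarith [hr.1], by linarith [hr.2]⟩)
      rwa [φ.map_zero_apply] at this
  refine pi_half_le_abs_of_opposite (h.orbit_ne a0 a2 b3) (h.orbit_ne a1 a0 b1)
    (mul_pos hc1 hc2) hd ?_ e3 ?_ ?_
  · rw [e2, e1, refAngle]
    push_cast
    rw [add_mul, Complex.exp_add]
    ring
  · have h1 := h.norm_sub_sub_le hp hq a2 a0 b2
    rw [φ.map_zero_apply] at *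
    rwa [φ.map_zero_apply, ← neg_sub x (φ (-δ) x), sub_neg_eq_add, norm_neg] at h1
  · have h1 := h.norm_sub_sub_le hp hq a1 a0 b1
    rwa [φ.map_zero_apply, φ.map_zero_apply] at *

lemma abs_sectionAngle_add_swap (h : IsSmallSection φ x δ ρ S) {p q : ℂ} (hp : p ∈ S)
    (hq : q ∈ S) (hpq : p ≠ q) :
    |sectionAngle φ δ p q + sectionAngle φ δ q p - 2 * refAngle φ δ x| ≤ 12 / 100 := by
  have hδ := h.delta_pos
  have a1 : |δ| ≤ 4 * δ := by rw [abs_of_pos hδ]; linarith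
  have a2 : |-δ| ≤ 4 * δ := by rwa [abs_neg]
  have hδδ : -δ ≤ δ := by linarith
  have hcx := φ.continuous_time x
  have hcp := φ.continuous_time p
  have hcq := φ.continuous_time q
  have hne : ∀ r ∈ Icc (-δ) δ, ∀ s ∈ Icc (-δ) δ, φ r q - φ s p ≠ 0 := fun r hr s hs =>
    h.map_ne hp hq hpq (abs_le.2 ⟨by linarith [hr.1, hs.2], by linarith [hr.2, hs.1]⟩)
  obtain ⟨L, hL, hLF⟩ := exists_log_rect (F := fun r s => φ r q - φ s p) hδδ hδδ
    ((hcq.comp continuous_fst).sub (hcp.comp continuous_snd)).continuousOn hne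
  have hL1 : ∀ s, Continuous fun r => L r s := fun s => hL.comp (Continuous.prodMk_left s)
  have hL2 : ∀ r, Continuous fun s => L r s := fun r => hL.comp (Continuous.prodMk_right r)
  have m0 : (0 : ℝ) ∈ Icc (-δ) δ := ⟨by linarith, hδ.le⟩
  have ml : -δ ∈ Icc (-δ) δ := left_mem_Icc.2 hδδ
  have mr : δ ∈ Icc (-δ) δ := right_mem_Icc.2 hδδ
  have e1 : sectionAngle φ δ p q = (L δ 0 - L (-δ) 0).im :=
    argInc_eq_of_exp_eq (L := fun r => L r 0) hδδ (hL1 0).continuousOn fun r hr => by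
      rw [hLF r hr 0 m0, φ.map_zero_apply]
  have e2 : sectionAngle φ δ q p = (L 0 δ - L 0 (-δ)).im := by
    rw [sectionAngle, argInc_sub_comm (fun r => φ r p) (fun _ => q) hδδ hcp continuous_const]
    · exact argInc_eq_of_exp_eq (L := fun s => L 0 s) hδδ (hL2 0).continuousOn fun s hs => by
        rw [hLF 0 m0 s hs, φ.map_zero_apply]
    · intro r hr
      have := hne 0 m0 r hr
      rw [φ.map_zero_apply] at this
      rwa [← neg_ne_zero, neg_sub]
  have nb : ∀ t ∈ Icc (-δ) δ, |t| ≤ 4 * δ := fun t ht =>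
    abs_le.2 ⟨by linarith [ht.1], by linarith [ht.2]⟩
  have k1 : |(L δ (-δ) - L 0 (-δ)).im - argInc (fun r => φ r x - φ (-δ) x) 0 δ| ≤ 3 / 100 := by
    have hs : ∀ r ∈ Icc 0 δ, r ∈ Icc (-δ) δ ∧ δ ≤ |r - -δ| := fun r hr =>
      ⟨⟨by linarith [hr.1], hr.2⟩, by rw [abs_of_nonneg] <;> linarith [hr.1]⟩
    rw [← argInc_eq_of_exp_eq (f := fun r => φ r q - φ (-δ) p) (L := fun r => L r (-δ)) hδ.le
      (hL1 _).continuousOn fun r hr => hLF r (hs r hr).1 _ ml]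
    exact abs_argInc_sub_le hδ.le (hcq.sub continuous_const).continuousOn
      (hcx.sub continuous_const).continuousOn
      (fun r hr => h.orbit_ne (nb r (hs r hr).1) a2 (hs r hr).2)
      fun r hr => h.norm_sub_sub_le hp hq (nb r (hs r hr).1) a2 (hs r hr).2
  have k2 : |(L δ 0 - L δ (-δ)).im - argInc (fun s => φ δ x - φ s x) (-δ) 0| ≤ 3 / 100 := by
    have hs : ∀ s ∈ Icc (-δ) 0, s ∈ Icc (-δ) δ ∧ δ ≤ |δ - s| := fun r hr =>
      ⟨⟨hr.1, by linarith [hr.2]⟩, by rw [abs_of_nonneg] <;> linarith [hr.2]⟩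
    rw [← argInc_eq_of_exp_eq (f := fun s => φ δ q - φ s p) (L := fun s => L δ s) m0.1
      (hL2 _).continuousOn fun s hs' => hLF δ mr s (hs s hs').1]
    exact abs_argInc_sub_le m0.1 (continuous_const.sub hcp).continuousOn
      (continuous_const.sub hcx).continuousOn
      (fun r hr => h.orbit_ne a1 (nb r (hs r hr).1) (hs r hr).2)
      fun r hr => h.norm_sub_sub_le hp hq a1 (nb r (hs r hr).1) (hs r hr).2
  have k3 : |(L (-δ) δ - L (-δ) 0).im - argInc (fun r => φ r x - φ (-δ) x) 0 δ| ≤ 3 / 100 := by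
    have hs : ∀ r ∈ Icc 0 δ, r ∈ Icc (-δ) δ ∧ δ ≤ |r - -δ| := fun r hr =>
      ⟨⟨by linarith [hr.1], hr.2⟩, by rw [abs_of_nonneg] <;> linarith [hr.1]⟩
    rw [← argInc_eq_of_exp_eq (f := fun s => φ (-δ) q - φ s p) (L := fun s => L (-δ) s) hδ.le
      (hL2 _).continuousOn fun s hs' => hLF _ ml s (hs s hs').1,
      argInc_sub_comm (fun _ => φ (-δ) q) (fun s => φ s p) hδ.le continuous_const hcp
        fun r hr => hne _ ml r (hs r hr).1]
    exact abs_argInc_sub_le hδ.le (hcp.sub continuous_const).continuousOn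
      (hcx.sub continuous_const).continuousOn
      (fun r hr => h.orbit_ne (nb r (hs r hr).1) a2 (hs r hr).2)
      fun r hr => h.norm_sub_sub_le hq hp (nb r (hs r hr).1) a2 (hs r hr).2
  have k4 : |(L 0 δ - L (-δ) δ).im - argInc (fun s => φ δ x - φ s x) (-δ) 0| ≤ 3 / 100 := by
    have hs : ∀ s ∈ Icc (-δ) 0, s ∈ Icc (-δ) δ ∧ δ ≤ |δ - s| := fun r hr =>
      ⟨⟨hr.1, by linarith [hr.2]⟩, by rw [abs_of_nonneg] <;> linarith [hr.2]⟩
    rw [← argInc_eq_of_exp_eq (f := fun r => φ r q - φ δ p) (L := fun r => L r δ) m0.1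
      (hL1 _).continuousOn fun s hs' => hLF s (hs s hs').1 δ mr,
      argInc_sub_comm (fun r => φ r q) (fun _ => φ δ p) m0.1 hcq continuous_const
        fun r hr => hne r (hs r hr).1 _ mr]
    exact abs_argInc_sub_le m0.1 (continuous_const.sub hcq).continuousOn
      (continuous_const.sub hcx).continuousOn
      (fun r hr => h.orbit_ne a1 (nb r (hs r hr).1) (hs r hr).2)
      fun r hr => h.norm_sub_sub_le hq hp a1 (nb r (hs r hr).1) (hs r hr).2
  rw [e1, e2, refAngle]
  simp only [Complex.sub_im, abs_le] at *
  obtain ⟨k11, k12⟩ := k1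
  obtain ⟨k21, k22⟩ := k2
  obtain ⟨k31, k32⟩ := k3
  obtain ⟨k41, k42⟩ := k4
  constructor <;> linarith

lemma eventually_abs_sectionAngle_sub_le (h : IsSmallSection φ x δ ρ S) {p q : ℂ} (hp : p ∈ S)
    (hq : q ∈ S) (hpq : p ≠ q) :
    ∀ᶠ p' in 𝓝 p, |sectionAngle φ δ p' q - sectionAngle φ δ p q| ≤ 3 / 100 := by
  have hδ := h.delta_pos
  have hδδ : -δ ≤ δ := by linarith
  have hc : Continuous fun r => φ r q - p := (φ.continuous_time q).sub continuous_const
  have hne : ∀ r ∈ Icc (-δ) δ, φ r q - p ≠ 0 := fun r hr => by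
    have := h.map_ne hp hq hpq (t := r) (s := 0)
      (abs_le.2 ⟨by linarith [hr.1], by linarith [hr.2]⟩)
    rwa [φ.map_zero_apply] at this
  obtain ⟨r₀, hr₀, hmin⟩ := isCompact_Icc.exists_isMinOn (nonempty_Icc.2 hδδ)
    hc.norm.continuousOn
  have hpos := norm_pos_iff.2 (hne r₀ hr₀)
  filter_upwards [closedBall_mem_nhds p (by positivity : 0 < ‖φ r₀ q - p‖ / 100)] with p' hp'
  refine abs_argInc_sub_le hδδ ((φ.continuous_time q).sub continuous_const).continuousOn
    hc.continuousOn hne fun r hr => ?_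
  have h1 : ‖φ r₀ q - p‖ ≤ ‖φ r q - p‖ := hmin hr
  rw [mem_closedBall, dist_comm, dist_eq_norm] at hp'
  have : φ r q - p' - (φ r q - p) = p - p' := by ring
  rw [this]
  linarith

end IsSmallSection
namespace IsSmallSection

variable {φ : Flow ℝ ℂ} {x : ℂ} {δ ρ : ℝ} {S : Set ℂ}

lemma exists_abs_shifted_sectionAngle_sub_le (h : IsSmallSection φ x δ ρ S) :
    ∃ C : ℝ, ∀ p ∈ S, ∀ q ∈ S, p ≠ q →
      |argInc (fun r => φ (r + δ) q - φ δ p) (-δ) δ - sectionAngle φ δ p q - C| ≤ 6 / 100 := by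
  have hδ := h.delta_pos
  have hδδ : -δ ≤ δ := by linarith
  have hb : ∀ u ∈ Icc 0 δ, |u| ≤ 4 * δ ∧ |-δ + u| ≤ 4 * δ ∧ |δ + u| ≤ 4 * δ ∧
      δ ≤ |-δ + u - u| ∧ δ ≤ |δ + u - u| := fun u hu => by
    refine ⟨abs_le.2 ⟨by linarith [hu.1], by linarith [hu.2]⟩,
      abs_le.2 ⟨by linarith [hu.1], by linarith [hu.2]⟩,
      abs_le.2 ⟨by linarith [hu.1], by linarith [hu.2]⟩, ?_, ?_⟩
    · rw [add_sub_cancel_right, abs_neg]; exact le_abs_self δ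
    · rw [add_sub_cancel_right]; exact le_abs_self δ
  have hc : ∀ y e, Continuous fun u => φ (e + u) y := fun y e =>
    (φ.continuous_time y).comp (continuous_const.add continuous_id)
  refine ⟨argInc (fun u => φ (δ + u) x - φ u x) 0 δ -
    argInc (fun u => φ (-δ + u) x - φ u x) 0 δ, fun p hp q hq hpq => ?_⟩
  have hne : ∀ r ∈ Icc (-δ) δ, ∀ u ∈ Icc 0 δ, φ (r + u) q - φ u p ≠ 0 := fun r hr u _ =>
    h.map_ne hp hq hpq (by
      rw [add_sub_cancel_right]
      exact abs_le.2 ⟨by linarith [hr.1], by linarith [hr.2]⟩)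
  have key := argInc_rect (F := fun r u => φ (r + u) q - φ u p) hδδ hδ.le
    (Continuous.continuousOn (((φ.continuous_time q).comp
      (continuous_fst.add continuous_snd)).sub ((φ.continuous_time p).comp continuous_snd))) hne
  simp only [add_zero, φ.map_zero_apply] at key
  have k1 := abs_argInc_sub_le (f := fun u => φ (-δ + u) q - φ u p)
    (g := fun u => φ (-δ + u) x - φ u x) hδ.le
    ((hc q (-δ)).sub (φ.continuous_time p)).continuousOn
    ((hc x (-δ)).sub (φ.continuous_time x)).continuousOn
    (fun u hu => by
      obtain ⟨h1, h2, h3, h4, h5⟩ := hb u hu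
      exact h.orbit_ne h2 h1 h4)
    (fun u hu => by
      obtain ⟨h1, h2, h3, h4, h5⟩ := hb u hu
      exact h.norm_sub_sub_le hp hq h2 h1 h4)
  have k2 := abs_argInc_sub_le (f := fun u => φ (δ + u) q - φ u p)
    (g := fun u => φ (δ + u) x - φ u x) hδ.le
    ((hc q δ).sub (φ.continuous_time p)).continuousOn
    ((hc x δ).sub (φ.continuous_time x)).continuousOn
    (fun u hu => by
      obtain ⟨h1, h2, h3, h4, h5⟩ := hb u hu
      exact h.orbit_ne h3 h1 h5)
    (fun u hu => by
      obtain ⟨h1, h2, h3, h4, h5⟩ := hb u hu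
      exact h.norm_sub_sub_le hp hq h3 h1 h5)
  rw [sectionAngle]
  rw [abs_le] at *
  constructor <;> linarith

lemma add_lt_of_hits (h : IsSmallSection φ x δ ρ S) {t s : ℝ} (hts : t < s) (ht : φ t x ∈ S)
    (hs : φ s x ∈ S) : t + 4 * δ < s := by
  by_contra! hcon
  refine h.notMem _ ht (s - t) (by linarith) (abs_le.2 ⟨by linarith, by linarith⟩) ?_
  rwa [← φ.map_add, sub_add_cancel]

lemma argInc_orbit_shift (φ : Flow ℝ ℂ) (y c : ℂ) {e δ : ℝ} (hδ : 0 ≤ δ)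
    (hne : ∀ r ∈ Icc (-δ + e) (δ + e), φ r y - c ≠ 0) :
    argInc (fun r => φ r y - c) (-δ + e) (δ + e) = argInc (fun r => φ (r + e) y - c) (-δ) δ :=
  (argInc_comp_add (f := fun r => φ r y - c) e (by linarith)
    ((φ.continuous_time y).sub continuous_const).continuousOn hne).symm

lemma abs_sectionAngle_consecutive (h : IsSmallSection φ x δ ρ S)
    (hx : ∀ t, t ≠ 0 → φ t x ≠ x) {t₀ t₁ t₂ : ℝ} (h₀₁ : t₀ < t₁) (h₁₂ : t₁ < t₂)
    (m₀ : φ t₀ x ∈ S) (m₁ : φ t₁ x ∈ S) (m₂ : φ t₂ x ∈ S)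
    (g₁ : ∀ t ∈ Ioo t₀ t₁, φ t x ∉ S) (g₂ : ∀ t ∈ Ioo t₁ t₂, φ t x ∉ S) :
    |sectionAngle φ δ (φ t₁ x) (φ t₂ x) - sectionAngle φ δ (φ t₀ x) (φ t₁ x)| ≤ 48 / 100 := by
  have hδ := h.delta_pos
  have d₁ := h.add_lt_of_hits h₀₁ m₀ m₁
  have d₂ := h.add_lt_of_hits h₁₂ m₁ m₂
  have hinj : ∀ r s, r ≠ s → φ r x - φ s x ≠ 0 := fun r s hrs h0 =>
    hx (r - s) (sub_ne_zero.2 hrs) (φ.eq_of_map_eq (sub_eq_zero.1 h0))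
  have hne : ∀ r s, r ≠ s → φ r x ≠ φ s x := fun r s hrs => sub_ne_zero.1 (hinj r s hrs)
  have hγ := φ.continuous_time x
  have hγc : ∀ c : ℂ, Continuous fun r => φ r x - c := fun c => hγ.sub continuous_const
  have key := argInc_rect (F := fun r s => φ r x - φ s x) (a := t₁ + δ) (b := t₂ + δ)
    (c := t₀) (d := t₁) (by linarith) h₀₁.le
    ((hγ.comp continuous_fst).sub (hγ.comp continuous_snd)).continuousOn
    fun r hr s hs => hinj r s (by linarith [hr.1, hs.2])
  have a0 : |(0 : ℝ)| ≤ 4 * δ := by rw [abs_zero]; positivity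
  have a1 : |δ| ≤ 4 * δ := by rw [abs_of_pos hδ]; linarith
  have a2 : |-δ| ≤ 4 * δ := by rwa [abs_neg]
  have a3 : |2 * δ| ≤ 4 * δ := by rw [abs_of_pos (by linarith)]; linarith
  have b1 : δ ≤ |δ - 0| := by rw [sub_zero]; exact le_abs_self δ
  have b2 : δ ≤ |-δ - 0| := by rw [sub_zero, abs_neg]; exact le_abs_self δ
  have b3 : δ ≤ |0 - δ| := by rw [abs_sub_comm]; exact b1
  have b4 : δ ≤ |2 * δ - δ| := by
    have : 2 * δ - δ = δ := by ring
    rw [this]; exact le_abs_self δ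
  have hmove : ∀ t e, φ (t + e) x = φ e (φ t x) := fun t e => by rw [add_comm, φ.map_add]
  have split₁ : ∀ s, s ≤ t₁ → argInc (fun r => φ r x - φ s x) (t₁ + δ) (t₂ + δ) =
      argInc (fun r => φ r x - φ s x) (t₁ + δ) (t₂ - δ) +
        sectionAngle φ δ (φ s x) (φ t₂ x) := fun s hs => by
    have hn : ∀ r ∈ Icc (t₁ + δ) (t₂ + δ), φ r x - φ s x ≠ 0 := fun r hr =>
      hinj r s (by linarith [hr.1])
    have := argInc_orbit_shift φ x (φ s x) (e := t₂) hδ.le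
      (fun r hr => hn r ⟨by linarith [hr.1], by linarith [hr.2]⟩)
    rw [argInc_add (b := t₂ - δ) (by linarith) (by linarith) (hγc _).continuousOn hn,
      sectionAngle]
    simp only [← φ.map_add]
    rw [← this, neg_add_eq_sub, add_comm δ t₂]
  have split₂ : ∀ t, t₁ ≤ t → argInc (fun s => φ (t + δ) x - φ s x) t₀ t₁ =
      argInc (fun r => φ (r + δ) (φ t₀ x) - φ δ (φ t x)) (-δ) δ +
      argInc (fun s => φ s x - φ (t + δ) x) (t₀ + 2 * δ) t₁ := fun t ht => by
    have hn : ∀ r ∈ Icc t₀ t₁, φ r x - φ (t + δ) x ≠ 0 := fun r hr =>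
      hinj r _ (by linarith [hr.2])
    have := argInc_orbit_shift φ x (φ (t + δ) x) (e := δ + t₀) hδ.le
      (fun r hr => hn r ⟨by linarith [hr.1], by linarith [hr.2]⟩)
    have e1 : -δ + (δ + t₀) = t₀ := by ring
    have e2 : δ + (δ + t₀) = t₀ + 2 * δ := by ring
    rw [e1, e2] at this
    rw [argInc_sub_comm (fun _ => φ (t + δ) x) (fun s => φ s x) h₀₁.le continuous_const hγ
      fun r hr => hinj _ r (by linarith [hr.2]),
      argInc_add (b := t₀ + 2 * δ) (by linarith) (by linarith) (hγc _).continuousOn hn, this]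
    simp only [← φ.map_add, add_assoc, add_comm δ t]
  have c₁ := abs_argInc_sub_le_of_isPathConnected (c := fun r => φ r x)
    (v := φ δ x - φ 0 x) (w := φ (-δ) x - φ 0 x) h.isPathConnected m₀ m₁
    (by linarith : t₁ + δ ≤ t₂ - δ) hγ.continuousOn
    (fun t ht => g₂ t ⟨by linarith [ht.1], by linarith [ht.2]⟩)
    (h.orbit_ne a1 a0 b1) (h.orbit_ne a2 a0 b2)
    (fun k hk => by
      have := h.norm_sub_sub_le hk m₁ a1 a0 b1
      rwa [φ.map_zero_apply k, ← hmove] at this)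
    (fun k hk => by
      have := h.norm_sub_sub_le hk m₂ a2 a0 b2
      rwa [φ.map_zero_apply k, ← hmove, ← sub_eq_add_neg] at this)
  have c₂ := abs_argInc_sub_le_of_isPathConnected (c := fun r => φ r x)
    (v := φ (2 * δ) x - φ δ x) (w := φ 0 x - φ δ x)
    (h.isPathConnected.image (φ.continuous continuous_const continuous_id : Continuous (φ δ)))
    (mem_image_of_mem _ m₁) (mem_image_of_mem _ m₂)
    (by linarith : t₀ + 2 * δ ≤ t₁) hγ.continuousOn
    (by
      rintro t ht ⟨k, hk, hkt⟩
      refine g₁ (t - δ) ⟨by linarith [ht.1], by linarith [ht.2]⟩ ?_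
      have : φ (t - δ) x = k := φ.eq_of_map_eq hkt.symm
      rwa [this])
    (h.orbit_ne a3 a1 b4) (h.orbit_ne a0 a1 b3)
    (by
      rintro _ ⟨k, hk, rfl⟩
      have := h.norm_sub_sub_le hk m₀ a3 a1 b4
      rwa [← hmove] at this)
    (by
      rintro _ ⟨k, hk, rfl⟩
      have := h.norm_sub_sub_le hk m₁ a0 a1 b3
      rwa [φ.map_zero_apply (φ t₁ x)] at this)
  obtain ⟨C, hC⟩ := h.exists_abs_shifted_sectionAngle_sub_le
  have s₁ := hC _ m₁ _ m₀ (hne _ _ h₀₁.ne')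
  have s₂ := hC _ m₂ _ m₀ (hne _ _ (h₀₁.trans h₁₂).ne')
  have w₁ := h.abs_sectionAngle_add_swap m₀ m₁ (hne _ _ h₀₁.ne)
  have w₂ := h.abs_sectionAngle_add_swap m₀ m₂ (hne _ _ (h₀₁.trans h₁₂).ne)
  simp only [← hmove] at c₂
  rw [split₁ t₀ h₀₁.le, split₁ t₁ le_rfl, split₂ t₁ le_rfl, split₂ t₂ h₁₂.le] at key
  rw [abs_le] at *
  constructor <;> linarith

end IsSmallSection
lemma exists_isSmallSection (φ : Flow ℝ ℂ) {x : ℂ} (hx : ∀ t, t ≠ 0 → φ t x ≠ x) :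
    ∃ δ ρ S, IsSmallSection φ x δ ρ S ∧
      ∀ W ∈ 𝓝 x, ∀ᶠ q in 𝓝 x, ∃ τ, |τ| ≤ 1 ∧ φ τ q ∈ S ∩ W := by
  obtain ⟨δ, hδ, hsec⟩ := exists_local_section φ (hx 1 one_ne_zero)
  have hcx := φ.continuous_time x
  obtain ⟨ρ, hρ, hfar⟩ : ∃ ρ > 0, ∀ t s, |t| ≤ 4 * δ → |s| ≤ 4 * δ → δ ≤ |t - s| →
      1000 * ρ ≤ ‖φ t x - φ s x‖ := by
    let Q : Set (ℝ × ℝ) := (Icc (-(4 * δ)) (4 * δ) ×ˢ Icc (-(4 * δ)) (4 * δ)) ∩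
      {z | δ ≤ |z.1 - z.2|}
    have hQ : IsCompact Q := (isCompact_Icc.prod isCompact_Icc).inter_right
      (isClosed_le continuous_const (continuous_fst.sub continuous_snd).abs)
    have hQne : Q.Nonempty := ⟨(δ, 0), ⟨⟨by linarith, by linarith⟩, ⟨by linarith, by linarith⟩⟩,
      by simpa using le_abs_self δ⟩
    have hc : Continuous fun z : ℝ × ℝ => ‖φ z.1 x - φ z.2 x‖ :=
      ((hcx.comp continuous_fst).sub (hcx.comp continuous_snd)).norm
    obtain ⟨z, hz, hmin⟩ := hQ.exists_isMinOn hQne hc.continuousOn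
    have hpos : 0 < ‖φ z.1 x - φ z.2 x‖ := by
      refine norm_pos_iff.2 fun h0 => ?_
      refine hx (z.1 - z.2) (fun h => ?_) (φ.eq_of_map_eq (sub_eq_zero.1 h0))
      have : δ ≤ |z.1 - z.2| := hz.2
      rw [h, abs_zero] at this
      linarith
    refine ⟨‖φ z.1 x - φ z.2 x‖ / 1000, by positivity, fun t s ht hs hts => ?_⟩
    have : ‖φ z.1 x - φ z.2 x‖ ≤ ‖φ t x - φ s x‖ :=
      hmin (show (t, s) ∈ Q from ⟨⟨abs_le.1 ht, abs_le.1 hs⟩, hts⟩)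
    linarith
  have hclose : ∀ᶠ p in 𝓝 x, ∀ t ∈ Icc (-(4 * δ)) (4 * δ), ‖φ t p - φ t x‖ < ρ := by
    refine isCompact_Icc.eventually_forall_of_forall_eventually fun t _ => ?_
    have hc : Continuous fun z : ℂ × ℝ => ‖φ z.2 z.1 - φ z.2 x‖ :=
      ((φ.continuous continuous_snd continuous_fst).sub (hcx.comp continuous_snd)).norm
    refine hc.continuousAt.eventually (gt_mem_nhds ?_)
    simpa using hρ
  obtain ⟨S, hSV, hpc, hxS, hnot, hret⟩ := hsec _ hclose
  exact ⟨δ, ρ, S, ⟨hδ, hρ, hpc, hxS, hnot, fun p hp t ht => (hSV hp t (abs_le.1 ht)).le, hfar⟩,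
    hret⟩

namespace IsSmallSection

variable {φ : Flow ℝ ℂ} {x : ℂ} {δ ρ : ℝ} {S : Set ℂ}

lemma exists_next_hit (h : IsSmallSection φ x δ ρ S) {t t' : ℝ} (htt : t < t')
    (ht : φ t' x ∈ S) : ∃ s, t < s ∧ φ s x ∈ S ∧ ∀ u ∈ Ioo t s, φ u x ∉ S := by
  let A : Set ℝ := {s | t < s ∧ φ s x ∈ S}
  have hA : A.Nonempty := ⟨t', htt, ht⟩
  have hbdd : BddBelow A := ⟨t, fun s hs => hs.1.le⟩
  obtain ⟨s, hs, hlt⟩ := exists_lt_of_csInf_lt hA (lt_add_of_pos_right (sInf A) h.delta_pos)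
  refine ⟨s, hs.1, hs.2, fun u hu huS => ?_⟩
  have h1 := csInf_le hbdd (show u ∈ A from ⟨hu.1, huS⟩)
  have h2 := h.add_lt_of_hits hu.2 huS hs.2
  linarith [h.delta_pos]

lemma exists_hit_sequence (h : IsSmallSection φ x δ ρ S)
    (hhit : ∀ W ∈ 𝓝 x, ∀ N : ℝ, ∃ t ≥ N, φ t x ∈ S ∩ W) :
    ∃ T : ℕ → ℝ, T 0 = 0 ∧ (∀ n, T n < T (n + 1)) ∧ (∀ n, φ (T n) x ∈ S) ∧
      (∀ n, ∀ u ∈ Ioo (T n) (T (n + 1)), φ u x ∉ S) ∧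
      ∀ W ∈ 𝓝 x, ∃ n ≥ 2, φ (T n) x ∈ W := by
  have hnext : ∀ t, ∃ s, t < s ∧ φ s x ∈ S ∧ ∀ u ∈ Ioo t s, φ u x ∉ S := fun t => by
    obtain ⟨t', ht', hS, -⟩ := hhit univ univ_mem (t + 1)
    exact h.exists_next_hit (by linarith) hS
  choose nx hnx1 hnx2 hnx3 using hnext
  let T : ℕ → ℝ := fun n => nx^[n] 0
  have hT : ∀ n, T (n + 1) = nx (T n) := fun n => Function.iterate_succ_apply' nx n 0
  have hlt : ∀ n, T n < T (n + 1) := fun n => hT n ▸ hnx1 _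
  have hS : ∀ n, φ (T n) x ∈ S := fun n => by
    cases n with
    | zero => exact (φ.map_zero_apply x).symm ▸ h.mem
    | succ n => exact hT n ▸ hnx2 _
  have hgap : ∀ n, ∀ u ∈ Ioo (T n) (T (n + 1)), φ u x ∉ S := fun n => hT n ▸ hnx3 _
  have hmono : StrictMono T := strictMono_nat_of_lt_succ hlt
  refine ⟨T, rfl, hlt, hS, hgap, fun W hW => ?_⟩
  obtain ⟨t, ht, htS, htW⟩ := hhit W hW (T 2)
  have hgrow : ∀ n : ℕ, n * δ ≤ T n := fun n => by
    induction n with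
    | zero => simp [T]
    | succ n ih =>
      have := h.add_lt_of_hits (hlt n) (hS n) (hS (n + 1))
      push_cast
      linarith [h.delta_pos]
  have hex : ∃ n : ℕ, t < T n := by
    obtain ⟨n, hn⟩ := exists_nat_gt (t / δ)
    exact ⟨n, lt_of_lt_of_le ((div_lt_iff₀ h.delta_pos).1 hn) (hgrow n)⟩
  classical
  obtain ⟨n, hn, hmin⟩ : ∃ n, t < T n ∧ ∀ m < n, ¬ t < T m :=
    ⟨Nat.find hex, Nat.find_spec hex, fun m hm => Nat.find_min hex hm⟩
  have h2n : 2 < n := hmono.lt_iff_lt.1 (lt_of_le_of_lt ht hn)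
  obtain ⟨k, rfl⟩ : ∃ k, n = k + 1 := ⟨n - 1, by omega⟩
  have hk : T k ≤ t := not_lt.1 (hmin k (by omega))
  rcases hk.eq_or_lt with hk | hk
  · exact ⟨k, by omega, hk ▸ htW⟩
  · exact absurd htS (hgap k t ⟨hk, hn⟩)

lemma not_hits_recurrent (h : IsSmallSection φ x δ ρ S) (hx : ∀ t, t ≠ 0 → φ t x ≠ x)
    (hhit : ∀ W ∈ 𝓝 x, ∀ N : ℝ, ∃ t ≥ N, φ t x ∈ S ∩ W) : False := by
  obtain ⟨T, hT0, hlt, hS, hgap, hrec⟩ := h.exists_hit_sequence hhit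
  have hmono : StrictMono T := strictMono_nat_of_lt_succ hlt
  set κ := refAngle φ δ x with hκ
  have : PreconnectedSpace S :=
    Subtype.preconnectedSpace h.isPathConnected.isConnected.isPreconnected
  let r : S → S → Prop := fun p q => p ≠ q ∧ κ < sectionAngle φ δ p q
  have hirr : ∀ a, ¬ r a a := fun a ha => ha.1 rfl
  have hA : ∀ a b : S, a ≠ b → 1.57 ≤ |sectionAngle φ δ a b - κ| := fun a b hab =>
    h.abs_sectionAngle_sub_refAngle a.2 b.2 fun e => hab (Subtype.ext e)
  have hB : ∀ a b : S, a ≠ b →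
      |sectionAngle φ δ a b + sectionAngle φ δ b a - 2 * κ| ≤ 12 / 100 := fun a b hab =>
    h.abs_sectionAngle_add_swap a.2 b.2 fun e => hab (Subtype.ext e)
  have htot : ∀ a b, a ≠ b → (r a b ↔ ¬ r b a) := fun a b hab => by
    have h1 := hA a b hab
    have h2 := hB a b hab
    rw [abs_le] at h2
    simp only [r, hab, hab.symm, true_and, ne_eq, not_false_eq_true, not_lt]
    constructor
    · intro h3
      rw [abs_of_pos (by linarith)] at h1
      norm_num at h1
      linarith
    · intro h3
      by_contra! h4
      rw [abs_of_nonpos (by linarith)] at h1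
      norm_num at h1
      linarith
  have hev : ∀ a b : S, a ≠ b → ∀ᶠ c : S in 𝓝 a, c ≠ b ∧
      |sectionAngle φ δ c b - sectionAngle φ δ a b| ≤ 3 / 100 := fun a b hab =>
    Filter.Eventually.and (isOpen_ne.mem_nhds hab)
      (continuous_subtype_val.continuousAt.eventually
        (h.eventually_abs_sectionAngle_sub_le a.2 b.2 fun e => hab (Subtype.ext e)))
  have hl : ∀ b, IsOpen {a | r a b} := fun b => by
    refine isOpen_iff_mem_nhds.2 fun a ha => ?_
    have h1 := hA a b ha.1
    have h2 : κ < sectionAngle φ δ a b := ha.2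
    filter_upwards [hev a b ha.1] with c hc
    refine ⟨hc.1, ?_⟩
    have h3 := abs_le.1 hc.2
    rw [abs_of_pos (by linarith)] at h1
    norm_num at h1
    linarith
  have hr : ∀ a, IsOpen {b | r a b} := fun b => by
    refine isOpen_iff_mem_nhds.2 fun a ha => ?_
    have hab : a ≠ b := fun e => ha.1 e.symm
    have h1 := hA a b hab
    have h2 : ¬ κ < sectionAngle φ δ a b := fun h2 =>
      (htot a b hab).1 ⟨hab, h2⟩ ha
    filter_upwards [hev a b hab] with c hc
    have h3 := abs_le.1 hc.2
    rw [abs_of_nonpos (by linarith)] at h1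
    norm_num at h1
    refine (htot b c hc.1.symm).2 fun h4 => ?_
    have h5 : κ < sectionAngle φ δ c b := h4.2
    linarith
  let p : ℕ → S := fun n => ⟨φ (T n) x, hS n⟩
  have hpne : ∀ n, p n ≠ p (n + 1) := fun n e =>
    hx (T (n + 1) - T n) (sub_ne_zero.2 (hlt n).ne') (φ.eq_of_map_eq (Subtype.ext_iff.1 e).symm)
  have hstep : ∀ n, r (p n) (p (n + 1)) ↔ r (p (n + 1)) (p (n + 2)) := fun n => by
    have h1 := hA _ _ (hpne n)
    have h2 := hA _ _ (hpne (n + 1))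
    have h3 := h.abs_sectionAngle_consecutive hx (hlt n) (hlt (n + 1)) (hS _) (hS _) (hS _)
      (hgap n) (hgap (n + 1))
    change |sectionAngle φ δ (p (n + 1)) (p (n + 2)) - sectionAngle φ δ (p n) (p (n + 1))| ≤ _
      at h3
    simp only [r, hpne n, hpne (n + 1), ne_eq, not_false_eq_true, true_and]
    generalize sectionAngle φ δ (p n) (p (n + 1)) = u at *
    generalize sectionAngle φ δ (p (n + 1)) (p (n + 1 + 1)) = v at *
    rw [abs_le] at h3
    constructor
    · intro h4
      by_contra! h5
      rw [abs_of_nonpos (by linarith)] at h2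
      norm_num at h2
      linarith
    · intro h4
      by_contra! h5
      rw [abs_of_nonpos (by linarith)] at h1
      norm_num at h1
      linarith
  have hrecS : ∀ W ∈ 𝓝 (p 0), ∃ n ≥ 2, p n ∈ W := fun W hW => by
    rw [nhds_subtype_eq_comap] at hW
    simp only [hT0, φ.map_zero_apply] at hW
    obtain ⟨W', hW', hsub⟩ := hW
    obtain ⟨n, hn, hnW⟩ := hrec W' hW'
    exact ⟨n, hn, hsub hnW⟩
  by_cases h0 : r (p 0) (p 1)
  · have hall : ∀ n, r (p n) (p (n + 1)) := fun n => by
      induction n with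
      | zero => exact h0
      | succ n ih => exact (hstep n).1 ih
    exact not_recurrent_of_monotone hirr htot hl hr hall hrecS
  · have hall : ∀ n, ¬ r (p n) (p (n + 1)) := fun n => by
      induction n with
      | zero => exact h0
      | succ n ih => exact fun hn => ih ((hstep n).2 hn)
    exact not_recurrent_of_monotone (r := fun a b => r b a) hirr
      (fun a b hab => htot b a hab.symm) hr hl
      (fun n => (htot _ _ (hpne n).symm).2 (hall n)) hrecS

end IsSmallSection

/-- A recurrent point of a planar flow is periodic. -/
theorem exists_period_of_recurrent (φ : Flow ℝ ℂ) {x : ℂ}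
    (hrec : ∀ W ∈ 𝓝 x, ∀ N : ℝ, ∃ t ≥ N, φ t x ∈ W) : ∃ T > 0, φ T x = x := by
  by_contra! hcon
  have hx : ∀ t, t ≠ 0 → φ t x ≠ x := fun t ht h => by
    rcases ht.lt_or_gt with ht | ht
    · refine hcon (-t) (neg_pos.2 ht) ?_
      have := φ.eq_of_map_eq (t := 0) (s := t) (p := x) (q := x) (by rw [φ.map_zero_apply, h])
      rwa [zero_sub] at this
    · exact hcon t ht h
  obtain ⟨δ, ρ, S, h, hret⟩ := exists_isSmallSection φ hx
  refine h.not_hits_recurrent hx fun W hW N => ?_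
  obtain ⟨t, ht, τ, hτ, hS⟩ := hrec _ (hret W hW) (N + 1)
  rw [← φ.map_add] at hS
  exact ⟨τ + t, by linarith [(abs_le.1 hτ).1], hS⟩
/-- A point which is recurrent for all the maps `φ n`, where `n` is a positive integer. -/
def IsTotallyRecurrent {X : Type*} [TopologicalSpace X] (φ : Flow ℝ X) (x : X) : Prop :=
  ∀ n : ℕ, 0 < n → ∀ W ∈ 𝓝 x, ∃ᶠ k : ℕ in atTop, φ ((n * k : ℕ) : ℝ) x ∈ W

namespace IsTotallyRecurrent

variable {X : Type*} [TopologicalSpace X] {φ : Flow ℝ X} {x : X}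

lemma map (h : IsTotallyRecurrent φ x) (t : ℝ) : IsTotallyRecurrent φ (φ t x) := by
  intro n hn W hW
  have hc : Continuous (φ t) := φ.continuous continuous_const continuous_id
  refine (h n hn _ (hc.continuousAt hW)).mono fun k hk => ?_
  rw [← φ.map_add, add_comm, φ.map_add]
  exact hk

lemma exists_ge (h : IsTotallyRecurrent φ x) {W : Set X} (hW : W ∈ 𝓝 x) (N : ℝ) :
    ∃ t ≥ N, φ t x ∈ W := by
  obtain ⟨k, hk, hkW⟩ := (frequently_atTop.1 (h 1 one_pos W hW)) ⌈N⌉₊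
  refine ⟨_, ?_, hkW⟩
  rw [one_mul]
  exact (Nat.le_ceil N).trans (by exact_mod_cast hk)

end IsTotallyRecurrent

/-- The time-reversed flow preserves the order given by the closed cone `K`, whose
interior contains `J`. -/
structure IsBackwardMonotone {E : Type*} [NormedAddCommGroup E] (φ : Flow ℝ E) (K J : Set E) :
    Prop where
  isClosed : IsClosed K
  isOpen : IsOpen J
  zero_mem : (0 : E) ∈ K
  add_mem : ∀ u ∈ K, ∀ v ∈ K, u + v ∈ K
  add_mem' : ∀ u ∈ J, ∀ v ∈ K, u + v ∈ J
  subset : J ⊆ K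
  neg_notMem : ∀ v ∈ J, -v ∉ K
  map_sub_mem : ∀ t, 0 ≤ t → ∀ u v, v - u ∈ K → φ (-t) v - φ (-t) u ∈ K
  map_sub_mem' : ∀ t, 0 < t → ∀ u v, v ≠ u → v - u ∈ K → φ (-t) v - φ (-t) u ∈ J

namespace IsBackwardMonotone

variable {E : Type*} [NormedAddCommGroup E] {φ : Flow ℝ E} {K J : Set E}

lemma neg (h : IsBackwardMonotone φ K J) : IsBackwardMonotone φ (-K) (-J) where
  isClosed := h.isClosed.neg
  isOpen := h.isOpen.neg
  zero_mem := by simpa using h.zero_mem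
  add_mem u hu v hv := by
    rw [Set.mem_neg, neg_add]
    exact h.add_mem _ hu _ hv
  add_mem' u hu v hv := by
    rw [Set.mem_neg, neg_add]
    exact h.add_mem' _ hu _ hv
  subset := Set.neg_subset_neg.2 h.subset
  neg_notMem v hv := h.neg_notMem _ hv
  map_sub_mem t ht u v huv := by
    rw [Set.mem_neg, neg_sub] at *
    exact h.map_sub_mem t ht v u huv
  map_sub_mem' t ht u v hne huv := by
    rw [Set.mem_neg, neg_sub] at *
    exact h.map_sub_mem' t ht v u hne.symm huv

lemma map_sub_map_mem (h : IsBackwardMonotone φ K J) {w : E} {a : ℝ} (ha : 0 ≤ a)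
    (hw : w - φ (-a) w ∈ K) (j : ℕ) : φ (-a) w - φ (-((j + 1) * a)) w ∈ K := by
  induction j with
  | zero => simpa using h.zero_mem
  | succ j ih =>
    have h1 := h.map_sub_mem ((j + 1) * a) (by positivity) _ _ hw
    rw [← φ.map_add] at h1
    have h2 := h.add_mem _ ih _ h1
    rw [sub_add_sub_cancel] at h2
    convert h2 using 3
    push_cast
    ring

lemma sub_map_notMem_of_nat (h : IsBackwardMonotone φ K J) {w : E}
    (hw : IsTotallyRecurrent φ w) {m : ℕ} (hm : 0 < m) : w - φ (-m : ℝ) w ∉ J := by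
  intro hwJ
  have hc : Continuous (φ (-m : ℝ)) := φ.continuous continuous_const continuous_id
  have h1 : ∀ᶠ v in 𝓝 w, v - φ (-m : ℝ) v ∈ J :=
    (continuous_id.sub hc).continuousAt.eventually (h.isOpen.mem_nhds hwJ)
  have h2 : ∀ᶠ v in 𝓝 w, φ (-m : ℝ) v - w ∉ K := by
    refine (hc.sub continuous_const).continuousAt.eventually
      (h.isClosed.isOpen_compl.mem_nhds ?_)
    have := h.neg_notMem _ hwJ
    rwa [neg_sub] at this
  obtain ⟨k, ⟨hk1, hk2⟩, hk⟩ :=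
    ((hw m hm _ (h1.and h2)).and_eventually (eventually_ge_atTop 1)).exists
  obtain ⟨j, rfl⟩ : ∃ j, k = j + 1 := ⟨k - 1, by omega⟩
  have h3 := h.map_sub_map_mem (Nat.cast_nonneg m) (h.subset hk1) j
  rw [← φ.map_add (-((j + 1) * m : ℝ))] at h3
  have h4 : (-((j + 1) * m) + (m * (j + 1) : ℕ) : ℝ) = 0 := by push_cast; ring
  rw [h4, φ.map_zero_apply] at h3
  exact hk2 h3

lemma sub_map_notMem (h : IsBackwardMonotone φ K J) {w : E} (hw : IsTotallyRecurrent φ w)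
    {a : ℝ} (ha : 0 < a) : w - φ (-a) w ∉ J := by
  intro hwJ
  have hc : Continuous fun t : ℝ => w - φ (-t) w :=
    continuous_const.sub (φ.continuous continuous_neg continuous_const)
  obtain ⟨_, ⟨hqJ, hq0⟩, q, rfl⟩ := (Rat.denseRange_cast (𝕜 := ℝ)).inter_open_nonempty
    _ ((h.isOpen.preimage hc).inter isOpen_Ioi) ⟨a, hwJ, ha⟩
  have hq0' : 0 < q := by exact_mod_cast (show (0 : ℝ) < q from hq0)
  have hnum : 0 < q.num := Rat.num_pos.2 hq0'
  obtain ⟨j, hj⟩ : ∃ j, q.den = j + 1 := ⟨q.den - 1, by have := q.den_pos; omega⟩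
  obtain ⟨m, hm⟩ := Int.eq_ofNat_of_zero_le hnum.le
  have hm0 : 0 < m := by omega
  have h1 := h.map_sub_map_mem (le_of_lt hq0) (h.subset hqJ) j
  have h2 := h.add_mem' _ hqJ _ h1
  rw [sub_add_sub_cancel] at h2
  have h3 : ((j + 1) * q : ℝ) = m := by
    have : (q.den : ℝ) * q = q.num := by exact_mod_cast Rat.den_mul_eq_num q
    rw [hj, hm] at this
    exact_mod_cast this
  rw [h3] at h2
  exact h.sub_map_notMem_of_nat hw hm0 h2

/-- The orbit of a recurrent point is unordered. -/
lemma map_eq_of_sub_mem (h : IsBackwardMonotone φ K J) {x : E} (hx : IsTotallyRecurrent φ x)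
    {s t : ℝ} (hst : φ t x - φ s x ∈ K) : φ t x = φ s x := by
  by_contra hne
  have h1 := h.map_sub_mem' 1 one_pos _ _ hne hst
  have hmove : ∀ r, φ (-1) (φ r x) = φ (r - 1) x := fun r => by
    rw [← φ.map_add, neg_add_eq_sub]
  rw [hmove, hmove] at h1
  rcases lt_trichotomy s t with hlt | rfl | hlt
  · refine h.sub_map_notMem (hx.map (t - 1)) (sub_pos.2 hlt) ?_
    rw [← φ.map_add]
    convert h1 using 3
    ring
  · exact hne rfl
  · refine h.neg.sub_map_notMem (hx.map (s - 1)) (sub_pos.2 hlt) ?_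
    rw [← φ.map_add, Set.mem_neg, neg_sub]
    convert h1 using 3
    ring

end IsBackwardMonotone

namespace IsBackwardMonotone

variable {E : Type*} [NormedAddCommGroup E] {φ : Flow ℝ E} {K J : Set E}

/-- The smallest invariant upper set containing the point `x`. -/
def upperInvariant (φ : Flow ℝ E) (K : Set E) (x : E) : Set E :=
  {y | ∃ t : ℝ, 0 ≤ t ∧ ∃ s : ℝ, φ (-t) y - φ s x ∈ K}

lemma mem_upperInvariant (h : IsBackwardMonotone φ K J) (x : E) :
    x ∈ upperInvariant φ K x :=
  ⟨0, le_rfl, 0, by simpa using h.zero_mem⟩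

lemma upperInvariant_upper (h : IsBackwardMonotone φ K J) {x y v : E}
    (hy : y ∈ upperInvariant φ K x) (hv : v - y ∈ K) : v ∈ upperInvariant φ K x := by
  obtain ⟨t, ht, s, hs⟩ := hy
  refine ⟨t, ht, s, ?_⟩
  have := h.add_mem _ (h.map_sub_mem t ht _ _ hv) _ hs
  rwa [sub_add_sub_cancel] at this

lemma map_mem_upperInvariant (h : IsBackwardMonotone φ K J) {x y : E}
    (hy : y ∈ upperInvariant φ K x) (r : ℝ) : φ r y ∈ upperInvariant φ K x := by
  obtain ⟨t, ht, s, hs⟩ := hy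
  rcases le_total 0 (t + r) with h0 | h0
  · refine ⟨t + r, h0, s, ?_⟩
    rw [← φ.map_add]
    convert hs using 3
    ring
  · refine ⟨0, le_rfl, t + r + s, ?_⟩
    have := h.map_sub_mem (-(t + r)) (by linarith) _ _ hs
    rw [← φ.map_add, ← φ.map_add] at this
    rw [← φ.map_add]
    convert this using 3 <;> ring

lemma preimage_frontier_upperInvariant (h : IsBackwardMonotone φ K J) (x : E) (r : ℝ) :
    φ r ⁻¹' frontier (upperInvariant φ K x) = frontier (upperInvariant φ K x) := by
  have h1 : φ r ⁻¹' upperInvariant φ K x = upperInvariant φ K x := by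
    ext y
    refine ⟨fun hy => ?_, fun hy => h.map_mem_upperInvariant hy r⟩
    have := h.map_mem_upperInvariant hy (-r)
    rwa [← φ.map_add, neg_add_cancel, φ.map_zero_apply] at this
  have h2 := (φ.toHomeomorph r).preimage_frontier (upperInvariant φ K x)
  change φ r ⁻¹' _ = frontier (φ r ⁻¹' _) at h2
  rw [h2, h1]

lemma sub_notMem_upperInvariant (h : IsBackwardMonotone φ K J) {x : E}
    (hx : IsTotallyRecurrent φ x) {v : E} (hv : v ∈ J) (hv0 : v ≠ 0) :
    x - v ∉ upperInvariant φ K x := by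
  rintro ⟨t, ht, s, hs⟩
  have h1 : φ (-t) x - φ (-t) (x - v) ∈ J := by
    rcases ht.eq_or_lt with rfl | ht
    · simpa using hv
    · refine h.map_sub_mem' t ht _ _ ?_ ?_
      · simpa [eq_sub_iff_add_eq] using hv0
      · simpa using h.subset hv
  have h2 := h.add_mem _ (h.subset h1) _ hs
  rw [sub_add_sub_cancel] at h2
  have h3 := h.map_eq_of_sub_mem hx h2
  rw [← h3, ← neg_sub] at hs
  exact h.neg_notMem _ h1 hs

variable [NormedSpace ℝ E]

/-- The orbit of a totally recurrent point lies on an invariant hypersurface, which is a graph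
in the direction of a positive vector. -/
lemma exists_invariant_graph (h : IsBackwardMonotone φ K J)
    (hsmul : ∀ c : ℝ, 0 < c → ∀ v ∈ J, c • v ∈ J) {e : E} (he : e ∈ J) (he0 : e ≠ 0)
    {x : E} (hx : IsTotallyRecurrent φ x) :
    ∃ g : E → ℝ, Continuous g ∧ g x = 0 ∧ (∀ v s, g (v + s • e) = g v - s) ∧
      ∀ t v, g v = 0 → g (φ t v) = 0 := by
  set P := upperInvariant φ K x with hP
  have habs : ∀ v : E, ∃ s : ℝ, 0 < s ∧ v + s • e ∈ J := fun v => by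
    have hc : Continuous fun r : ℝ => e + r • v := by fun_prop
    have h1 : ∀ᶠ r in 𝓝 (0 : ℝ), e + r • v ∈ J :=
      hc.continuousAt.eventually (h.isOpen.mem_nhds (by simpa using he))
    obtain ⟨r, hr, hr0⟩ := ((h1.filter_mono nhdsWithin_le_nhds).and
      (self_mem_nhdsWithin : Ioi (0 : ℝ) ∈ 𝓝[>] 0)).exists
    refine ⟨r⁻¹, inv_pos.2 hr0, ?_⟩
    have := hsmul r⁻¹ (inv_pos.2 hr0) _ hr
    rwa [smul_add, smul_smul, inv_mul_cancel₀ (ne_of_gt hr0), one_smul, add_comm] at this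
  have hsm : ∀ c : ℝ, 0 ≤ c → c • e ∈ K := fun c hc => by
    rcases hc.eq_or_lt with rfl | hc
    · simpa using h.zero_mem
    · exact h.subset (hsmul c hc e he)
  have hxP : ∀ s : ℝ, x + s • e ∈ P → 0 ≤ s := fun s hs => by
    by_contra! hlt
    refine h.sub_notMem_upperInvariant hx (hsmul (-s) (neg_pos.2 hlt) e he)
      (smul_ne_zero (by linarith) he0) ?_
    simpa using hs
  have hne : ∀ v, {s : ℝ | v + s • e ∈ P}.Nonempty := fun v => by
    obtain ⟨s, -, hs⟩ := habs (v - x)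
    exact ⟨s, h.upperInvariant_upper (h.mem_upperInvariant x)
      (by convert h.subset hs using 1; abel)⟩
  have hbdd : ∀ v, BddBelow {s : ℝ | v + s • e ∈ P} := fun v => by
    obtain ⟨s, -, hs⟩ := habs (x - v)
    refine ⟨-s, fun r hr => ?_⟩
    have : x + (r + s) • e ∈ P := by
      refine h.upperInvariant_upper hr ?_
      convert h.subset hs using 1
      rw [add_smul]
      abel
    linarith [hxP _ this]
  obtain ⟨g, hg⟩ : ∃ g : E → ℝ, ∀ v, g v = sInf {s : ℝ | v + s • e ∈ P} := ⟨_, fun _ => rfl⟩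
  have hgle : ∀ v s, v + s • e ∈ P → g v ≤ s := fun v s hs => by
    rw [hg]
    exact csInf_le (hbdd v) hs
  have hlt : ∀ v s, g v < s → v + s • e ∈ P := fun v s hs => by
    rw [hg] at hs
    obtain ⟨r, hr, hrs⟩ := exists_lt_of_csInf_lt (hne v) hs
    refine h.upperInvariant_upper hr ?_
    convert hsm (s - r) (by linarith) using 1
    rw [sub_smul]
    abel
  have hle : ∀ v a, (∀ s, v + s • e ∈ P → a ≤ s) → a ≤ g v := fun v a ha => by
    rw [hg]
    exact le_csInf (hne v) ha
  have hshift : ∀ v s, g (v + s • e) = g v - s := fun v s => by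
    apply le_antisymm
    · rw [le_sub_iff_add_le]
      refine hle _ _ fun r hr => ?_
      have := hgle (v + s • e) (r - s) (by convert hr using 1; rw [sub_smul]; abel)
      linarith
    · refine hle _ _ fun r hr => ?_
      have := hgle v (s + r) (by rwa [add_smul, ← add_assoc])
      linarith
  have hnear : ∀ ε > 0, ∀ v w, w - v + ε • e ∈ J → g w ≤ g v + ε := fun ε hε v w hw => by
    rw [← sub_le_iff_le_add]
    refine hle _ _ fun r hr => ?_
    have := hgle w (r + ε) (h.upperInvariant_upper hr (by
      convert h.subset hw using 1
      rw [add_smul]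
      abel))
    linarith
  have hcont : Continuous g := by
    rw [continuous_iff_continuousAt]
    intro v
    rw [ContinuousAt, Metric.tendsto_nhds]
    intro ε hε
    have hε2 : 0 < ε / 2 := half_pos hε
    have h1 : ∀ᶠ w in 𝓝 v, w - v + (ε / 2) • e ∈ J := by
      have hc : Continuous fun w => w - v + (ε / 2) • e := by fun_prop
      exact hc.continuousAt.eventually (h.isOpen.mem_nhds (by simpa using hsmul _ hε2 e he))
    have h2 : ∀ᶠ w in 𝓝 v, v - w + (ε / 2) • e ∈ J := by
      have hc : Continuous fun w => v - w + (ε / 2) • e := by fun_prop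
      exact hc.continuousAt.eventually (h.isOpen.mem_nhds (by simpa using hsmul _ hε2 e he))
    filter_upwards [h1, h2] with w hw1 hw2
    have h3 := hnear _ hε2 _ _ hw1
    have h4 := hnear _ hε2 _ _ hw2
    rw [Real.dist_eq, abs_lt]
    constructor <;> linarith
  have hline : ∀ v, Continuous fun s : ℝ => v + s • e := fun v => by fun_prop
  have hfr : ∀ v, g v = 0 ↔ v ∈ frontier P := fun v => by
    constructor
    · intro hv
      refine ⟨?_, fun h_int => ?_⟩
      · have h1 : Tendsto (fun s : ℝ => v + s • e) (𝓝[>] 0) (𝓝 v) := by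
          have := ((hline v).tendsto 0).mono_left (nhdsWithin_le_nhds (s := Ioi 0))
          simpa using this
        refine mem_closure_of_tendsto h1 ?_
        filter_upwards [self_mem_nhdsWithin] with s hs
        exact hlt v s (by rw [hv]; exact hs)
      · have h1 : ∀ᶠ s in 𝓝 (0 : ℝ), v + s • e ∈ P :=
          (hline v).continuousAt.eventually (by
            simpa using mem_interior_iff_mem_nhds.1 h_int)
        obtain ⟨s, hs, hs0⟩ := ((h1.filter_mono nhdsWithin_le_nhds).and
          (self_mem_nhdsWithin : Iio (0 : ℝ) ∈ 𝓝[<] 0)).exists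
        have := hgle v s hs
        rw [hv] at this
        exact absurd hs0 (not_lt.2 this)
    · rintro ⟨h1, h2⟩
      apply le_antisymm
      · refine closure_minimal (t := {v | g v ≤ 0}) (fun w hw => hgle w 0 (by simpa using hw))
          (isClosed_le hcont continuous_const) h1
      · by_contra! hneg
        refine h2 (interior_maximal (s := P) (t := {v | g v < 0}) (fun w hw => ?_)
          (isOpen_lt hcont continuous_const) hneg)
        simpa using hlt w 0 hw
  refine ⟨g, hcont, le_antisymm (hgle x 0 (by simpa using h.mem_upperInvariant x))
    (hle x 0 hxP), hshift, fun t v hv => ?_⟩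
  rw [hfr] at hv ⊢
  rwa [← h.preimage_frontier_upperInvariant x t] at hv

/-- A totally recurrent point of a flow on a three-dimensional space, monotone in backward time,
is periodic. -/
lemma exists_period (h : IsBackwardMonotone φ K J)
    (hsmul : ∀ c : ℝ, 0 < c → ∀ v ∈ J, c • v ∈ J) {e : E} (he : e ∈ J) (he0 : e ≠ 0)
    (pr : E →L[ℝ] ℂ) (ι : ℂ →L[ℝ] E) (hpr : ∀ z, pr (ι z) = z) (hpre : pr e = 0)
    (hdec : ∀ v, ∃ c : ℝ, v = ι (pr v) + c • e) {x : E} (hx : IsTotallyRecurrent φ x) :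
    ∃ T > 0, φ T x = x := by
  obtain ⟨g, hg, hgx, hshift, hinv⟩ := h.exists_invariant_graph hsmul he he0 hx
  obtain ⟨m, hm⟩ : ∃ m : ℂ → E, ∀ z, m z = ι z + g (ι z) • e := ⟨_, fun _ => rfl⟩
  have hmc : Continuous m := by
    rw [show m = fun z => ι z + g (ι z) • e from funext hm]
    exact ι.continuous.add ((hg.comp ι.continuous).smul continuous_const)
  have hgm : ∀ z, g (m z) = 0 := fun z => by rw [hm, hshift, sub_self]
  have hprm : ∀ z, pr (m z) = z := fun z => by simp [hm, hpr, hpre]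
  have hmpr : ∀ v, g v = 0 → m (pr v) = v := fun v hv => by
    obtain ⟨c, hc⟩ := hdec v
    have h1 : g (ι (pr v)) = c := by
      rw [hc, hshift] at hv
      linarith
    rw [hm, h1, ← hc]
  let ψ : Flow ℝ ℂ :=
    { toFun := fun t z => pr (φ t (m z))
      cont' := pr.continuous.comp (φ.continuous continuous_fst (hmc.comp continuous_snd))
      map_add' := fun t s z => by
        rw [hmpr _ (hinv s _ (hgm z)), φ.map_add]
      map_zero' := fun z => by rw [φ.map_zero_apply, hprm] }
  have hψ : ∀ t, ψ t (pr x) = pr (φ t x) := fun t => by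
    change pr (φ t (m (pr x))) = _
    rw [hmpr x hgx]
  obtain ⟨T, hT, hTx⟩ := exists_period_of_recurrent ψ (x := pr x) fun W hW N => by
    obtain ⟨t, ht, htW⟩ := hx.exists_ge (pr.continuous.continuousAt hW) N
    exact ⟨t, ht, by rw [hψ]; exact htW⟩
  refine ⟨T, hT, ?_⟩
  rw [hψ] at hTx
  rw [← hmpr _ (hinv T x hgx), hTx, hmpr x hgx]

end IsBackwardMonotone

/-- The projection along a nonzero vector of a three-dimensional Euclidean space. -/
lemma exists_projection_complex {e : Euc 3} (he : e ≠ 0) :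
    ∃ (pr : Euc 3 →L[ℝ] ℂ) (ι : ℂ →L[ℝ] Euc 3), (∀ z, pr (ι z) = z) ∧ pr e = 0 ∧
      ∀ v, ∃ c : ℝ, v = ι (pr v) + c • e := by
  have h2 : Module.finrank ℝ (ℝ ∙ e)ᗮ = Module.finrank ℝ ℂ := by
    have : Fact (Module.finrank ℝ (Euc 3) = 2 + 1) := ⟨by simp⟩
    rw [Submodule.finrank_orthogonal_span_singleton (n := 2) he, Complex.finrank_real_complex]
  let L : (ℝ ∙ e)ᗮ ≃L[ℝ] ℂ := ContinuousLinearEquiv.ofFinrankEq h2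
  refine ⟨(L : (ℝ ∙ e)ᗮ →L[ℝ] ℂ) ∘L (ℝ ∙ e)ᗮ.orthogonalProjectionOnto,
    (ℝ ∙ e)ᗮ.subtypeL ∘L (L.symm : ℂ →L[ℝ] (ℝ ∙ e)ᗮ), fun z => ?_, ?_, fun v => ?_⟩
  · simp
  · simp [Submodule.mem_span_singleton_self]
  · have h1 : v - ((ℝ ∙ e)ᗮ.orthogonalProjectionOnto v : Euc 3) ∈ (ℝ ∙ e) := by
      have := Submodule.sub_starProjection_mem_orthogonal (K := (ℝ ∙ e)ᗮ) v
      rwa [Submodule.orthogonal_orthogonal] at this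
    obtain ⟨c, hc⟩ := Submodule.mem_span_singleton.1 h1
    refine ⟨c, ?_⟩
    rw [hc]
    simp

/-- The flow defined by `Φ`. -/
def IsFlow.toFlow {n : ℕ} {Φ : ℝ → Euc n → Euc n} (h : IsFlow Φ) : Flow ℝ (Euc n) where
  toFun := Φ
  cont' := h.1
  map_add' t s x := (h.2.2 t s x).symm
  map_zero' := h.2.1

lemma IsConeOrder.zero_mem {n : ℕ} {Cp : Set (Euc n)} (hC : IsConeOrder Cp) : 0 ∈ Cp :=
  (hC.2.2.2.2.symm ▸ mem_singleton _ : (0 : Euc n) ∈ Cp ∩ -Cp).1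

lemma IsConeOrder.smul_mem_interior {n : ℕ} {Cp : Set (Euc n)} (hC : IsConeOrder Cp) {c : ℝ}
    (hc : 0 < c) {v : Euc n} (hv : v ∈ interior Cp) : c • v ∈ interior Cp := by
  have h1 : c • interior Cp ⊆ interior Cp := by
    refine interior_maximal ?_ (isOpen_interior.smul₀ hc.ne')
    rintro _ ⟨w, hw, rfl⟩
    exact hC.2.2.1 c hc w (interior_subset hw)
  exact h1 (smul_mem_smul_set hv)

lemma IsConeOrder.add_mem_interior {n : ℕ} {Cp : Set (Euc n)} (hC : IsConeOrder Cp)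
    {u v : Euc n} (hu : u ∈ interior Cp) (hv : v ∈ Cp) : u + v ∈ interior Cp := by
  have h1 : interior Cp + Cp ⊆ interior Cp := by
    refine interior_maximal ?_ isOpen_interior.add_right
    rintro _ ⟨a, ha, b, hb, rfl⟩
    exact hC.2.1 a (interior_subset ha) b hb
  exact h1 (add_mem_add hu hv)

lemma IsConeOrder.zero_notMem_interior {n : ℕ} [NeZero n] {Cp : Set (Euc n)}
    (hC : IsConeOrder Cp) : (0 : Euc n) ∉ interior Cp := by
  intro h0
  obtain ⟨v, hv⟩ := exists_ne (0 : Euc n)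
  have hc : Continuous fun r : ℝ => r • v := by fun_prop
  have hc' : Continuous fun r : ℝ => -(r • v) := by fun_prop
  have h1 : ∀ᶠ r in 𝓝 (0 : ℝ), r • v ∈ interior Cp :=
    hc.continuousAt.eventually (isOpen_interior.mem_nhds (by simpa using h0))
  have h2 : ∀ᶠ r in 𝓝 (0 : ℝ), -(r • v) ∈ interior Cp :=
    hc'.continuousAt.eventually (isOpen_interior.mem_nhds (by simpa using h0))
  obtain ⟨r, ⟨hr1, hr2⟩, hr⟩ := (((h1.and h2).filter_mono nhdsWithin_le_nhds).and
    (self_mem_nhdsWithin : Ioi (0 : ℝ) ∈ 𝓝[>] 0)).exists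
  have h3 : r • v ∈ Cp ∩ -Cp := ⟨interior_subset hr1, interior_subset (s := Cp) hr2⟩
  rw [hC.2.2.2.2] at h3
  exact smul_ne_zero (ne_of_gt hr) hv h3

lemma StronglyCompetitive.isBackwardMonotone {n : ℕ} [NeZero n] {Φ : ℝ → Euc n → Euc n}
    {Cp : Set (Euc n)} (hΦ : IsFlow Φ) (hC : IsConeOrder Cp) (hcomp : StronglyCompetitive Φ Cp) :
    IsBackwardMonotone hΦ.toFlow Cp (interior Cp) where
  isClosed := hC.1
  isOpen := isOpen_interior
  zero_mem := hC.zero_mem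
  add_mem := hC.2.1
  add_mem' _ hu _ hv := hC.add_mem_interior hu hv
  subset := interior_subset
  neg_notMem v hv hv' := by
    have h3 : v ∈ Cp ∩ -Cp := ⟨interior_subset hv, hv'⟩
    rw [hC.2.2.2.2] at h3
    exact hC.zero_notMem_interior (h3 ▸ hv)
  map_sub_mem t ht u v huv := by
    rcases ht.eq_or_lt with rfl | ht
    · simpa [Flow.map_zero_apply] using huv
    · refine (hcomp t ht _ _).1 ?_
      change Φ t (Φ (-t) v) - Φ t (Φ (-t) u) ∈ Cp
      rwa [hΦ.2.2, hΦ.2.2, add_neg_cancel, hΦ.2.1, hΦ.2.1]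
  map_sub_mem' t ht u v hne huv := by
    refine (hcomp t ht _ _).2 ?_
    change Φ t (Φ (-t) v) - Φ t (Φ (-t) u) ∈ Cp ∧ Φ t (Φ (-t) v) ≠ Φ t (Φ (-t) u)
    rw [hΦ.2.2, hΦ.2.2, add_neg_cancel, hΦ.2.1, hΦ.2.1]
    exact ⟨huv, hne⟩

/-- Totally recurrent points of a strongly competitive three-dimensional flow are periodic. -/
theorem StronglyCompetitive.exists_period {Φ : ℝ → Euc 3 → Euc 3} {Cp : Set (Euc 3)}
    (hΦ : IsFlow Φ) (hC : IsConeOrder Cp) (hcomp : StronglyCompetitive Φ Cp) {x : Euc 3}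
    (hx : IsTotallyRecurrent hΦ.toFlow x) : ∃ T > 0, Φ T x = x := by
  obtain ⟨e, he⟩ := hC.2.2.2.1
  have he0 : e ≠ 0 := fun h => hC.zero_notMem_interior (h ▸ he)
  obtain ⟨pr, ι, h1, h2, h3⟩ := exists_projection_complex he0
  exact (isBackwardMonotone hΦ hC hcomp).exists_period
    (fun c hc v hv => hC.smul_mem_interior hc hv) he he0 pr ι h1 h2 h3 hx

/-- The set `Z` can be partitioned into `c` pieces, each of which has diameter less than `δ` at
all times less than `N`. -/
def Coverable {X : Type*} [PseudoMetricSpace X] (f : X → X) (δ : ℝ) (Z : Set X) (N c : ℕ) :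
    Prop :=
  ∃ code : X → ℕ, (∀ x ∈ Z, code x < c) ∧
    ∀ x ∈ Z, ∀ y ∈ Z, code x = code y → ∀ i < N, dist (f^[i] x) (f^[i] y) < δ

namespace Coverable

variable {X : Type*} [PseudoMetricSpace X] {f : X → X} {δ : ℝ} {Z Z' : Set X} {N N' c c' : ℕ}

lemma mono (h : Coverable f δ Z N c) (hZ : Z' ⊆ Z) (hN : N' ≤ N) : Coverable f δ Z' N' c := by
  obtain ⟨code, h1, h2⟩ := h
  exact ⟨code, fun x hx => h1 x (hZ hx), fun x hx y hy hxy i hi =>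
    h2 x (hZ hx) y (hZ hy) hxy i (hi.trans_le hN)⟩

lemma empty : Coverable f δ ∅ N 0 :=
  ⟨fun _ => 0, by simp, by simp⟩

lemma zero : Coverable f δ Z 0 1 :=
  ⟨fun _ => 0, by simp, by simp⟩

lemma union (h : Coverable f δ Z N c) (h' : Coverable f δ Z' N c') :
    Coverable f δ (Z ∪ Z') N (c + c') := by
  classical
  obtain ⟨u, h1, h2⟩ := h
  obtain ⟨v, h3, h4⟩ := h'
  refine ⟨fun x => if x ∈ Z then u x else c + v x, fun x hx => ?_, fun x hx y hy hxy => ?_⟩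
  · by_cases hxZ : x ∈ Z
    · simpa [hxZ] using (h1 x hxZ).trans_le (Nat.le_add_right _ _)
    · simpa [hxZ] using h3 x (hx.resolve_left hxZ)
  · by_cases hxZ : x ∈ Z <;> by_cases hyZ : y ∈ Z <;> simp only [hxZ, hyZ, if_true, if_false] at hxy
    · exact h2 x hxZ y hyZ hxy
    · have := h1 x hxZ
      omega
    · have := h1 y hyZ
      omega
    · exact h4 x (hx.resolve_left hxZ) y (hy.resolve_left hyZ) (by omega)

lemma concat (h : Coverable f δ Z N c) (h' : Coverable f δ Z' N' c')
    (hf : MapsTo f^[N] Z Z') : Coverable f δ Z (N + N') (c * c') := by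
  obtain ⟨u, h1, h2⟩ := h
  obtain ⟨v, h3, h4⟩ := h'
  refine ⟨fun x => u x + c * v (f^[N] x), fun x hx => ?_, fun x hx y hy hxy i hi => ?_⟩
  · have a1 := h1 x hx
    have a2 := h3 _ (hf hx)
    calc u x + c * v (f^[N] x) < c + c * v (f^[N] x) := by omega
      _ = c * (v (f^[N] x) + 1) := by ring
      _ ≤ c * c' := Nat.mul_le_mul_left _ a2
  · have a1 := h1 x hx
    have a2 := h1 y hy
    have hc : 0 < c := by omega
    dsimp only at hxy
    have e1 : u x = u y := by
      have := congrArg (· % c) hxy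
      simpa [Nat.add_mul_mod_self_left, Nat.mod_eq_of_lt a1, Nat.mod_eq_of_lt a2] using this
    have e2 : v (f^[N] x) = v (f^[N] y) := by
      rw [e1] at hxy
      exact Nat.eq_of_mul_eq_mul_left hc (Nat.add_left_cancel hxy)
    rcases lt_or_ge i N with hiN | hiN
    · exact h2 x hx y hy e1 i hiN
    · have := h4 _ (hf hx) _ (hf hy) e2 (i - N) (by omega)
      rwa [← Function.iterate_add_apply, ← Function.iterate_add_apply, Nat.sub_add_cancel hiN]
        at this

lemma biUnion {Z : ℕ → Set X} {B : ℕ → ℝ} (L : ℕ)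
    (h : ∀ l < L, ∃ c : ℕ, (c : ℝ) ≤ B l ∧ Coverable f δ (Z l) N c) :
    ∃ c : ℕ, (c : ℝ) ≤ ∑ l ∈ Finset.range L, B l ∧ Coverable f δ (⋃ l < L, Z l) N c := by
  induction L with
  | zero => exact ⟨0, by simp, by simpa using empty⟩
  | succ L ih =>
    obtain ⟨c, hc, hcov⟩ := ih fun l hl => h l (hl.trans L.lt_succ_self)
    obtain ⟨c', hc', hcov'⟩ := h L L.lt_succ_self
    refine ⟨c + c', ?_, ?_⟩
    · rw [Finset.sum_range_succ]
      push_cast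
      linarith
    · rw [biUnion_lt_succ]
      exact hcov.union hcov'

end Coverable

/-- The points whose first `N` iterates miss `V` at most `b` times. -/
def fewMisses {X : Type*} (f : X → X) (V : Set X) (N b : ℕ) : Set X :=
  {x | {i | i < N ∧ f^[i] x ∉ V}.ncard ≤ b}

lemma iterate_mem_fewMisses {X : Type*} {f : X → X} {V : Set X} {N b : ℕ} {x : X}
    (hx : x ∈ fewMisses f V N b) {T : ℕ} (hT : T ≤ N) : f^[T] x ∈ fewMisses f V (N - T) b := by
  refine le_trans ?_ (show {i | i < N ∧ f^[i] x ∉ V}.ncard ≤ b from hx)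
  refine ncard_le_ncard_of_injOn (fun i => i + T) (fun i hi => ?_)
    (add_left_injective T).injOn ((finite_lt_nat N).subset fun i hi => hi.1)
  refine ⟨?_, ?_⟩
  · have := hi.1
    omega
  · rw [Function.iterate_add_apply]
    exact hi.2

lemma map_mem_fewMisses {X : Type*} {f : X → X} {V : Set X} {N b : ℕ} {x : X}
    (hx : x ∈ fewMisses f V (N + 1) (b + 1)) (hxV : x ∉ V) : f x ∈ fewMisses f V N b := by
  have hfin : {i | i < N ∧ f^[i] (f x) ∉ V}.Finite := (finite_lt_nat N).subset fun i hi => hi.1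
  have h1 : insert 0 (Nat.succ '' {i | i < N ∧ f^[i] (f x) ∉ V}) ⊆
      {i | i < N + 1 ∧ f^[i] x ∉ V} := by
    rintro _ (rfl | ⟨i, hi, rfl⟩)
    · exact ⟨by omega, hxV⟩
    · exact ⟨Nat.succ_lt_succ hi.1, hi.2⟩
  have h2 := ncard_le_ncard h1 ((finite_lt_nat (N + 1)).subset fun i hi => hi.1)
  rw [ncard_insert_of_notMem (by simp) (hfin.image _),
    ncard_image_of_injective _ Nat.succ_injective] at h2
  exact Nat.le_of_succ_le_succ (h2.trans hx)

lemma notMem_fewMisses_zero {X : Type*} {f : X → X} {V : Set X} {N : ℕ} {x : X}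
    (hxV : x ∉ V) : x ∉ fewMisses f V (N + 1) 0 := by
  intro hx
  have h1 := (ncard_eq_zero ((finite_lt_nat (N + 1)).subset fun i hi => hi.1)).1
    (Nat.le_zero.1 hx)
  have : 0 ∈ {i | i < N + 1 ∧ f^[i] x ∉ V} := ⟨by omega, hxV⟩
  rw [h1] at this
  exact this

lemma coverable_fewMisses {X : Type*} [PseudoMetricSpace X] {f : X → X} {δ β : ℝ} (hβ : 0 ≤ β)
    {U : ℕ → Set X} {T C : ℕ → ℕ} {S M L : ℕ} (hS : 0 < S) (hT : ∀ l, 0 < T l)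
    (hTM : ∀ l < L, T l ≤ M) (hU : ∀ l, Coverable f δ (U l) (T l) (C l))
    (hC : ∀ l, (C l : ℝ) ≤ (1 / 2) ^ (l + 2) * Real.exp (β * T l))
    (hS1 : Coverable f δ univ 1 S) (N b : ℕ) :
    ∃ c : ℕ, (c : ℝ) ≤ Real.exp (β * (N + M)) * (2 * S) ^ b ∧
      Coverable f δ (fewMisses f (⋃ l < L, U l) N b) N c := by
  have hS' : (1 : ℝ) ≤ S := by exact_mod_cast hS
  induction N using Nat.strong_induction_on generalizing b with
  | _ N ih =>
  have hpow : (1 : ℝ) ≤ (2 * S) ^ b := one_le_pow₀ (by linarith)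
  rcases N.eq_zero_or_pos with rfl | hN
  · refine ⟨1, ?_, Coverable.zero⟩
    have : (1 : ℝ) ≤ Real.exp (β * ((0 : ℕ) + M)) := Real.one_le_exp (by positivity)
    push_cast at *
    nlinarith
  set B : ℝ := Real.exp (β * (N + M)) * (2 * S) ^ b with hB
  have hB0 : 0 < B := by positivity
  set V : Set X := ⋃ l < L, U l with hV
  have hin : ∀ l < L, ∃ c : ℕ, (c : ℝ) ≤ (1 / 2) ^ (l + 2) * B ∧
      Coverable f δ (fewMisses f V N b ∩ U l) N c := by
    intro l hl
    rcases le_or_gt N (T l) with hNT | hNT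
    · refine ⟨C l, (hC l).trans ?_, (hU l).mono inter_subset_right hNT⟩
      have h1 : Real.exp (β * T l) ≤ Real.exp (β * (N + M)) := by
        have : (T l : ℝ) ≤ M := by exact_mod_cast hTM l hl
        gcongr
        linarith [(Nat.cast_nonneg N : (0 : ℝ) ≤ N)]
      rw [hB]
      gcongr
      nlinarith [Real.exp_pos (β * (N + M))]
    · obtain ⟨c, hc, hcov⟩ := ih (N - T l) (Nat.sub_lt hN (hT l)) b
      refine ⟨C l * c, ?_, ?_⟩
      · push_cast
        calc (C l : ℝ) * c ≤ ((1 / 2) ^ (l + 2) * Real.exp (β * T l)) *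
              (Real.exp (β * ((N - T l : ℕ) + M)) * (2 * S) ^ b) := by
              gcongr
              exact hC l
          _ = (1 / 2) ^ (l + 2) * B := by
              rw [hB, Nat.cast_sub hNT.le,
                show β * (N + M) = β * T l + β * (N - T l + M) by ring, Real.exp_add]
              ring
      · have := ((hU l).mono (inter_subset_right (s := fewMisses f V N b)) le_rfl).concat hcov
          fun x hx => iterate_mem_fewMisses hx.1 hNT.le
        rwa [Nat.add_sub_cancel' hNT.le] at this
  have hout : ∃ c : ℕ, (c : ℝ) ≤ 1 / 2 * B ∧ Coverable f δ (fewMisses f V N b \ V) N c := by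
    obtain ⟨n, rfl⟩ : ∃ n, N = n + 1 := ⟨N - 1, by omega⟩
    cases b with
    | zero =>
      refine ⟨0, by push_cast; positivity, Coverable.empty.mono (fun x hx => ?_) le_rfl⟩
      exact notMem_fewMisses_zero hx.2 hx.1
    | succ b =>
      obtain ⟨c, hc, hcov⟩ := ih n n.lt_succ_self b
      refine ⟨S * c, ?_, ?_⟩
      · push_cast
        have h1 : Real.exp (β * (n + M)) ≤ Real.exp (β * ((n + 1 : ℕ) + M)) := by
          gcongr
          linarith
        calc (S : ℝ) * c ≤ S * (Real.exp (β * ((n + 1 : ℕ) + M)) * (2 * S) ^ b) := by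
              gcongr
              exact hc.trans (by gcongr)
          _ = 1 / 2 * B := by
              rw [hB]
              ring
      · have := (hS1.mono (subset_univ (fewMisses f V (n + 1) (b + 1) \ V)) le_rfl).concat hcov
          fun x hx => map_mem_fewMisses hx.1 hx.2
        rwa [add_comm 1 n] at this
  obtain ⟨c, hc, hcov⟩ := Coverable.biUnion L hin
  obtain ⟨c', hc', hcov'⟩ := hout
  refine ⟨c + c', ?_, (hcov.union hcov').mono (fun x hx => ?_) le_rfl⟩
  · rw [← Finset.sum_mul] at hc
    have h1 : ∑ l ∈ Finset.range L, (1 / 2 : ℝ) ^ (l + 2) ≤ 1 / 2 := by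
      have h2 := sum_geometric_two_le L
      simp_rw [pow_add, ← Finset.sum_mul]
      linarith
    push_cast
    nlinarith
  · by_cases hxV : x ∈ V
    · left
      rw [hV, mem_iUnion₂] at hxV
      obtain ⟨l, hl, hxl⟩ := hxV
      exact mem_iUnion₂.2 ⟨l, hl, hx, hxl⟩
    · exact Or.inr ⟨hx, hxV⟩

lemma exists_code_dist_lt {X : Type*} [PseudoMetricSpace X] [CompactSpace X] {ρ : ℝ}
    (hρ : 0 < ρ) : ∃ (c : ℕ) (code : X → ℕ), (∀ x, code x < c) ∧
      ∀ x y, code x = code y → dist x y < ρ := by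
  obtain ⟨t, -, htf, ht⟩ := finite_cover_balls_of_compact (isCompact_univ (X := X)) (half_pos hρ)
  have hcov : ∀ x : X, ∃ p : t, dist x p < ρ / 2 := fun x => by
    obtain ⟨p, hp, hx⟩ := mem_iUnion₂.1 (ht (mem_univ x))
    exact ⟨⟨p, hp⟩, hx⟩
  choose p hp using hcov
  have := htf.fintype
  refine ⟨Fintype.card t, fun x => Fintype.equivFin t (p x), fun x => Fin.is_lt _,
    fun x y hxy => ?_⟩
  have h1 : p x = p y := (Fintype.equivFin t).injective (Fin.val_injective hxy)
  have h2 := hp y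
  rw [← h1, dist_comm] at h2
  linarith [dist_triangle x (p x) y, hp x]

/-- The points which have a period between `1` and `L`. -/
def boundedPeriod {X : Type*} [TopologicalSpace X] (φ : Flow ℝ X) (L : ℝ) : Set X :=
  {x | ∃ p, 1 ≤ p ∧ p ≤ L ∧ φ p x = x}

section

variable {X : Type*} [MetricSpace X] (φ : Flow ℝ X)

lemma Flow.iterate_map_one (i : ℕ) (x : X) : (φ 1)^[i] x = φ i x := by
  induction i generalizing x with
  | zero => simp [φ.map_zero_apply]
  | succ i ih => rw [Function.iterate_succ_apply, ih, ← φ.map_add, Nat.cast_succ]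

lemma Flow.map_nsmul_period {p : ℝ} {x : X} (h : φ p x = x) (k : ℕ) : φ (k * p) x = x := by
  induction k with
  | zero => simp [φ.map_zero_apply]
  | succ k ih => rw [Nat.cast_succ, add_mul, one_mul, φ.map_add, h, ih]

lemma Flow.map_sub_nsmul_period {p : ℝ} {x : X} (h : φ p x = x) (t : ℝ) (k : ℕ) :
    φ (t - k * p) x = φ t x := by
  conv_rhs => rw [← sub_add_cancel t (k * p), φ.map_add, φ.map_nsmul_period h]

lemma Flow.exists_mem_boundedPeriod {T : ℝ} (hT : 0 < T) {x : X} (h : φ T x = x) :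
    ∃ l : ℕ, x ∈ boundedPeriod φ l := by
  obtain ⟨k, hk⟩ := exists_nat_gt (1 / T)
  rw [div_lt_iff₀ hT] at hk
  obtain ⟨l, hl⟩ := exists_nat_gt (k * T)
  exact ⟨l, k * T, hk.le, hl.le, φ.map_nsmul_period h k⟩

lemma Coverable.exists_isOpen {f : X → X} (hf : Continuous f) {δ : ℝ} (hδ : 0 < δ) {Z : Set X}
    {N c : ℕ} (h : Coverable f δ Z N c) :
    ∃ U, IsOpen U ∧ Z ⊆ U ∧ Coverable f (2 * δ) U N c := by
  obtain ⟨code, h1, h2⟩ := h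
  refine ⟨⋃ x ∈ Z, ⋂ i ∈ Finset.range N, {y | dist (f^[i] y) (f^[i] x) < δ / 2}, ?_, ?_, ?_⟩
  · refine isOpen_biUnion fun x _ => isOpen_biInter_finset fun i _ => ?_
    exact isOpen_lt ((hf.iterate i).dist continuous_const) continuous_const
  · refine fun x hx => mem_iUnion₂.2 ⟨x, hx, mem_iInter₂.2 fun i _ => ?_⟩
    simpa using hδ
  · classical
    have hex : ∀ y, ∃ x, y ∈ (⋃ x ∈ Z, ⋂ i ∈ Finset.range N,
        {y | dist (f^[i] y) (f^[i] x) < δ / 2}) →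
        x ∈ Z ∧ ∀ i < N, dist (f^[i] y) (f^[i] x) < δ / 2 := fun y => by
      by_cases hy : y ∈ (⋃ x ∈ Z, ⋂ i ∈ Finset.range N, {y | dist (f^[i] y) (f^[i] x) < δ / 2})
      · obtain ⟨x, hx, hxy⟩ := mem_iUnion₂.1 hy
        exact ⟨x, fun _ => ⟨hx, fun i hi => mem_iInter₂.1 hxy i (Finset.mem_range.2 hi)⟩⟩
      · exact ⟨y, fun h => absurd h hy⟩
    choose q hq using hex
    refine ⟨fun y => code (q y), fun y hy => h1 _ (hq y hy).1, fun y hy z hz hyz i hi => ?_⟩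
    have d1 := (hq y hy).2 i hi
    have d2 := h2 _ (hq y hy).1 _ (hq z hz).1 hyz i hi
    have d3 := (hq z hz).2 i hi
    rw [dist_comm] at d3
    linarith [dist_triangle (f^[i] y) (f^[i] (q y)) (f^[i] z),
      dist_triangle (f^[i] (q y)) (f^[i] (q z)) (f^[i] z)]

variable [CompactSpace X]

lemma Flow.exists_dist_map_lt {ε : ℝ} (hε : 0 < ε) :
    ∃ η > 0, ∀ r, |r| ≤ η → ∀ z, dist (φ r z) z < ε := by
  have h1 : ∀ᶠ r in 𝓝 (0 : ℝ), ∀ z ∈ (univ : Set X), dist (φ r z) z < ε := by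
    refine isCompact_univ.eventually_forall_of_forall_eventually fun z _ => ?_
    have hc : Continuous fun p : ℝ × X => dist (φ p.1 p.2) p.2 :=
      (φ.continuous continuous_fst continuous_snd).dist continuous_snd
    refine hc.continuousAt.eventually (gt_mem_nhds ?_)
    simpa [φ.map_zero_apply] using hε
  obtain ⟨η, hη, h⟩ := Metric.eventually_nhds_iff.1 h1
  refine ⟨η / 2, half_pos hη, fun r hr z => h ?_ z (mem_univ z)⟩
  rw [Real.dist_eq, sub_zero]
  linarith

lemma Flow.exists_dist_map_map_lt {ε : ℝ} (hε : 0 < ε) (L : ℝ) :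
    ∃ ρ > 0, ∀ x y, dist x y < ρ → ∀ t ∈ Icc 0 L, dist (φ t x) (φ t y) < ε := by
  have hc : ContinuousOn (fun p : ℝ × X => φ p.1 p.2) (Icc 0 L ×ˢ univ) :=
    (φ.continuous continuous_fst continuous_snd).continuousOn
  have hu := (isCompact_Icc.prod isCompact_univ).uniformContinuousOn_of_continuous hc
  obtain ⟨ρ, hρ, h⟩ := Metric.uniformContinuousOn_iff.1 hu ε hε
  refine ⟨ρ, hρ, fun x y hxy t ht => h (t, x) ⟨ht, mem_univ _⟩ (t, y) ⟨ht, mem_univ _⟩ ?_⟩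
  rw [Prod.dist_eq]
  simpa [hρ] using hxy

/-- Points with a bounded period are covered by a number of pieces which grows linearly. -/
lemma exists_coverable_boundedPeriod {δ : ℝ} (hδ : 0 < δ) (L : ℝ) :
    ∃ A : ℝ, ∀ T : ℕ, 0 < T → ∃ c : ℕ, (c : ℝ) ≤ A * T ∧
      Coverable (φ 1) δ (boundedPeriod φ L) T c := by
  obtain ⟨η, hη, hη'⟩ := φ.exists_dist_map_lt (half_pos hδ)
  obtain ⟨ρ, hρ, hρ'⟩ := φ.exists_dist_map_map_lt (half_pos hδ) L
  obtain ⟨c, code, hcode, hcode'⟩ := exists_code_dist_lt (X := X) hρ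
  refine ⟨(|L| / η + 1) * c, fun T hT => ?_⟩
  have hT' : (1 : ℝ) ≤ T := by exact_mod_cast hT
  classical
  have hex : ∀ x, ∃ p : ℝ, x ∈ boundedPeriod φ L → 1 ≤ p ∧ p ≤ L ∧ φ p x = x := fun x => by
    by_cases hx : x ∈ boundedPeriod φ L
    · obtain ⟨p, hp⟩ := hx
      exact ⟨p, fun _ => hp⟩
    · exact ⟨0, fun h => absurd h hx⟩
  choose p hp using hex
  refine ⟨c * (⌊|L| * T / η⌋₊ + 1), ?_, fun x => code x + c * ⌊p x * T / η⌋₊, fun x hx => ?_,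
    fun x hx y hy hxy i hi => ?_⟩
  · have h1 : (⌊|L| * T / η⌋₊ : ℝ) ≤ |L| * T / η := Nat.floor_le (by positivity)
    have hc0 : (0 : ℝ) ≤ c := Nat.cast_nonneg c
    push_cast
    calc (c : ℝ) * (⌊|L| * T / η⌋₊ + 1) ≤ c * (|L| * T / η + T) := by gcongr
      _ = (|L| / η + 1) * c * T := by ring
  · have h1 : ⌊p x * T / η⌋₊ ≤ ⌊|L| * T / η⌋₊ := by
      have := (hp x hx).2.1.trans (le_abs_self L)
      gcongr
    have h2 := hcode x
    calc code x + c * ⌊p x * T / η⌋₊ < c + c * ⌊p x * T / η⌋₊ := by omega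
      _ = c * (⌊p x * T / η⌋₊ + 1) := by ring
      _ ≤ _ := Nat.mul_le_mul_left _ (by omega)
  · dsimp only at hxy
    have a1 := hcode x
    have a2 := hcode y
    have e1 : code x = code y := by
      have := congrArg (· % c) hxy
      simpa [Nat.add_mul_mod_self_left, Nat.mod_eq_of_lt a1, Nat.mod_eq_of_lt a2] using this
    have e2 : ⌊p x * T / η⌋₊ = ⌊p y * T / η⌋₊ := by
      rw [e1] at hxy
      exact Nat.eq_of_mul_eq_mul_left (by omega) (Nat.add_left_cancel hxy)
    obtain ⟨hx1, hx2, hx3⟩ := hp x hx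
    obtain ⟨hy1, hy2, hy3⟩ := hp y hy
    have hpp : |p x - p y| * T ≤ η := by
      have b1 := Nat.floor_le (show 0 ≤ p x * T / η by positivity)
      have b2 := Nat.lt_floor_add_one (p x * T / η)
      have b3 := Nat.floor_le (show 0 ≤ p y * T / η by positivity)
      have b4 := Nat.lt_floor_add_one (p y * T / η)
      rw [e2] at b1 b2
      have b5 : |p x * T / η - p y * T / η| ≤ 1 := by
        rw [abs_le]
        constructor <;> linarith
      rw [← sub_div, ← sub_mul, abs_div, abs_mul, abs_of_pos hη, div_le_iff₀ hη,
        abs_of_nonneg (Nat.cast_nonneg T : (0 : ℝ) ≤ T)] at b5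
      linarith
    set k : ℕ := ⌊i / p x⌋₊ with hk
    have hk1 : (k : ℝ) * p x ≤ i := by
      rw [← le_div_iff₀ (by linarith)]
      exact Nat.floor_le (by positivity)
    have hk2 : (i : ℝ) - k * p x ≤ p x := by
      have := (Nat.lt_floor_add_one ((i : ℝ) / p x)).le
      rw [div_le_iff₀ (by linarith), ← hk] at this
      linarith
    have hkT : (k : ℝ) ≤ T := by
      have : (i : ℝ) ≤ T := by exact_mod_cast hi.le
      nlinarith [(Nat.cast_nonneg k : (0 : ℝ) ≤ k)]
    have hr : |(k : ℝ) * (p x - p y)| ≤ η := by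
      rw [abs_mul, abs_of_nonneg (Nat.cast_nonneg k)]
      nlinarith [abs_nonneg (p x - p y)]
    rw [φ.iterate_map_one, φ.iterate_map_one, ← φ.map_sub_nsmul_period hx3 i k,
      ← φ.map_sub_nsmul_period hy3 i k,
      show (i : ℝ) - k * p y = k * (p x - p y) + (i - k * p x) by ring, φ.map_add]
    have d1 := hρ' x y (hcode' x y e1) (i - k * p x) ⟨by linarith, by linarith⟩
    have d2 := hη' _ hr (φ (i - k * p x) y)
    rw [dist_comm] at d2
    linarith [dist_triangle (φ (i - k * p x) x) (φ (i - k * p x) y)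
      (φ (k * (p x - p y)) (φ (i - k * p x) y))]

/-- Points with a bounded period have an open neighbourhood of small exponential complexity. -/
lemma exists_isOpen_coverable {δ β κ : ℝ} (hδ : 0 < δ) (hβ : 0 < β) (hκ : 0 < κ) (L : ℝ) :
    ∃ (U : Set X) (T c : ℕ), IsOpen U ∧ boundedPeriod φ L ⊆ U ∧ 0 < T ∧
      (c : ℝ) ≤ κ * Real.exp (β * T) ∧ Coverable (φ 1) δ U T c := by
  obtain ⟨A, hA⟩ := exists_coverable_boundedPeriod φ (half_pos hδ) L
  have h1 : Tendsto (fun T : ℕ => A * ((T : ℝ) * Real.exp (-(β * T)))) atTop (𝓝 0) := by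
    have h2 := (Real.tendsto_pow_mul_exp_neg_atTop_nhds_zero 1).comp
      ((tendsto_natCast_atTop_atTop (R := ℝ)).const_mul_atTop hβ)
    have h3 := h2.const_mul (A / β)
    rw [mul_zero] at h3
    refine h3.congr fun T => ?_
    simp only [Function.comp_apply, pow_one]
    field_simp
  obtain ⟨T, hT, hT0⟩ := ((h1.eventually (gt_mem_nhds hκ)).and (eventually_gt_atTop 0)).exists
  obtain ⟨c, hc, hcov⟩ := hA T hT0
  obtain ⟨U, hU, hsub, hcovU⟩ := hcov.exists_isOpen
    (φ.continuous continuous_const continuous_id) (half_pos hδ)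
  refine ⟨U, T, c, hU, hsub, hT0, hc.trans ?_, by rwa [mul_div_cancel₀ _ two_ne_zero] at hcovU⟩
  rw [← mul_assoc, Real.exp_neg, ← div_eq_mul_inv, div_lt_iff₀ (Real.exp_pos _)] at hT
  exact hT.le

end

section

open MeasureTheory
open scoped ENNReal BoundedContinuousFunction

variable {X : Type*} [MeasurableSpace X]

/-- The uniform measure on an orbit segment of length `N + 1`. -/
def orbitMeasure (f : X → X) (N : ℕ) (x : X) : Measure X :=
  ((N + 1 : ℕ) : ℝ≥0∞)⁻¹ • ∑ i ∈ Finset.range (N + 1), Measure.dirac (f^[i] x)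

instance (f : X → X) (N : ℕ) (x : X) : IsProbabilityMeasure (orbitMeasure f N x) := by
  constructor
  simp only [orbitMeasure, Measure.smul_apply, Measure.finsetSum_apply, measure_univ,
    Finset.sum_const, Finset.card_range, nsmul_eq_mul, mul_one, smul_eq_mul]
  exact ENNReal.inv_mul_cancel (by simp) (ENNReal.natCast_ne_top _)

lemma orbitMeasure_apply (f : X → X) (N : ℕ) (x : X) {F : Set X} (hF : MeasurableSet F) :
    orbitMeasure f N x F =
      ((N + 1 : ℕ) : ℝ≥0∞)⁻¹ * ({i | i < N + 1 ∧ f^[i] x ∈ F}.ncard : ℕ) := by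
  classical
  have h1 : {i | i < N + 1 ∧ f^[i] x ∈ F} =
      ((Finset.range (N + 1)).filter fun i => f^[i] x ∈ F : Finset ℕ) := by
    ext i
    simp
  rw [h1, ncard_coe_finset, Finset.card_filter]
  simp [orbitMeasure, Measure.dirac_apply' _ hF, indicator_apply]

end

section

open MeasureTheory
open scoped ENNReal BoundedContinuousFunction

variable {X : Type*} [MetricSpace X] [MeasurableSpace X] [BorelSpace X]

lemma integral_orbitMeasure (f : X → X) (N : ℕ) (x : X) (g : X →ᵇ ℝ) :
    ∫ y, g y ∂orbitMeasure f N x =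
      ((N + 1 : ℕ) : ℝ)⁻¹ * ∑ i ∈ Finset.range (N + 1), g (f^[i] x) := by
  rw [orbitMeasure, integral_smul_measure, integral_finsetSum_measure]
  · rw [ENNReal.toReal_inv, ENNReal.toReal_natCast, smul_eq_mul]
    simp
  · intro i _
    exact g.integrable _

lemma abs_integral_comp_sub_integral_orbitMeasure_le {f : X → X} (hf : Continuous f) (N : ℕ)
    (x : X) (g : X →ᵇ ℝ) :
    |∫ y, g (f y) ∂orbitMeasure f N x - ∫ y, g y ∂orbitMeasure f N x| ≤ 2 * ‖g‖ / (N + 1) := by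
  have h1 := integral_orbitMeasure f N x (g.compContinuous ⟨f, hf⟩)
  simp only [BoundedContinuousFunction.compContinuous_apply, ContinuousMap.coe_mk] at h1
  have h2 : ∑ i ∈ Finset.range (N + 1), g (f (f^[i] x)) - ∑ i ∈ Finset.range (N + 1), g (f^[i] x)
      = g (f^[N + 1] x) - g x := by
    rw [← Finset.sum_sub_distrib]
    simp_rw [← Function.iterate_succ_apply' f]
    rw [Finset.sum_range_sub fun i => g (f^[i] x)]
    rfl
  rw [h1, integral_orbitMeasure, ← mul_sub, h2, abs_mul, abs_of_pos (by positivity),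
    inv_mul_eq_div, Nat.cast_succ]
  gcongr
  have h3 := g.norm_coe_le_norm (f^[N + 1] x)
  have h4 := g.norm_coe_le_norm x
  rw [Real.norm_eq_abs, abs_le] at h3 h4
  rw [abs_le]
  constructor <;> linarith

/-- A form of the Poincaré recurrence theorem. -/
lemma ae_isTotallyRecurrent [SecondCountableTopology X] (φ : Flow ℝ X) {μ : Measure X}
    [IsProbabilityMeasure μ] (hμ : MeasurePreserving (φ 1) μ μ) :
    ∀ᵐ x ∂μ, IsTotallyRecurrent φ x := by
  have h1 : ∀ n : ℕ, ∀ᵐ x ∂μ, ∀ W ∈ 𝓝 x, ∃ᶠ k : ℕ in atTop, ((φ 1)^[n])^[k] x ∈ W :=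
    fun n => (hμ.iterate n).conservative.ae_frequently_mem_of_mem_nhds
  filter_upwards [ae_all_iff.2 h1] with x hx n _ W hW
  refine (hx n W hW).mono fun k hk => ?_
  rwa [← Function.iterate_mul, φ.iterate_map_one] at hk

variable [CompactSpace X]

/-- A union of open sets which has full measure for all invariant measures is visited with
uniformly large frequency. -/
lemma exists_forall_ncard_le {f : X → X} (hf : Continuous f) {U : ℕ → Set X}
    (hU : ∀ l, IsOpen (U l))
    (hfull : ∀ μ : Measure X, IsProbabilityMeasure μ → MeasurePreserving f μ μ →
      ∀ᵐ x ∂μ, x ∈ ⋃ l, U l) {ε : ℝ} (hε : 0 < ε) :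
    ∃ L N₀ : ℕ, ∀ N ≥ N₀, ∀ x, ({i | i < N ∧ f^[i] x ∉ ⋃ l < L, U l}.ncard : ℝ) ≤ ε * N := by
  by_contra! hcon
  have hseq : ∀ L : ℕ, ∃ N ≥ L, ∃ x,
      ε * (N + 1 : ℕ) < ({i | i < N + 1 ∧ f^[i] x ∉ ⋃ l < L, U l}.ncard : ℝ) := fun L => by
    obtain ⟨N, hN, x, hx⟩ := hcon L (L + 1)
    obtain ⟨n, rfl⟩ : ∃ n, N = n + 1 := ⟨N - 1, by omega⟩
    exact ⟨n, by omega, x, hx⟩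
  choose N hN x hx using hseq
  let m : ℕ → ProbabilityMeasure X := fun L => ⟨orbitMeasure f (N L) (x L), inferInstance⟩
  obtain ⟨u, hu⟩ : ∃ u : Ultrafilter ℕ, (u : Filter ℕ) ≤ atTop := ⟨_, Ultrafilter.of_le _⟩
  obtain ⟨μ, -, hμ⟩ := isCompact_univ.ultrafilter_le_nhds (u.map m) (by simp)
  have hlim : Tendsto m u (𝓝 μ) := hμ
  have h_int := ProbabilityMeasure.tendsto_iff_forall_integral_tendsto.1 hlim
  have hNlim : Tendsto N u atTop := (tendsto_atTop_mono hN tendsto_id).mono_left hu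
  have hinv : MeasurePreserving f (μ : Measure X) μ := by
    refine ⟨hf.measurable, ?_⟩
    have := Measure.isProbabilityMeasure_map (μ := (μ : Measure X)) hf.measurable.aemeasurable
    refine ext_of_forall_integral_eq_of_IsFiniteMeasure fun g => ?_
    rw [integral_map hf.measurable.aemeasurable g.continuous.measurable.aestronglyMeasurable]
    have h1 := (h_int (g.compContinuous ⟨f, hf⟩)).sub (h_int g)
    have h2 : Tendsto (fun L => 2 * ‖g‖ / ((N L : ℝ) + 1)) u (𝓝 0) :=
      Tendsto.div_atTop tendsto_const_nhds
        (tendsto_atTop_add_const_right _ _ (tendsto_natCast_atTop_atTop.comp hNlim))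
    have h3 := tendsto_nhds_unique h1 (squeeze_zero_norm
      (fun L => abs_integral_comp_sub_integral_orbitMeasure_le hf (N L) (x L) g) h2)
    exact sub_eq_zero.1 h3
  have hclosed : ∀ L, IsClosed (⋃ l < L, U l)ᶜ := fun L =>
    (isOpen_biUnion fun l _ => hU l).isClosed_compl
  have hge : ∀ L, ENNReal.ofReal ε ≤ (μ : Measure X) (⋃ l < L, U l)ᶜ := fun L => by
    refine le_trans ?_
      (ProbabilityMeasure.limsup_measure_closed_le_of_tendsto hlim (hclosed L))
    refine le_limsup_of_frequently_le ?_ (by isBoundedDefault)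
    refine Eventually.frequently (hu (eventually_atTop.2 ⟨L, fun k hk => ?_⟩))
    have h1 : (⋃ l < k, U l)ᶜ ⊆ (⋃ l < L, U l)ᶜ :=
      compl_subset_compl.2 (biUnion_subset_biUnion_left fun l hl => lt_of_lt_of_le hl hk)
    refine le_trans ?_ (measure_mono h1)
    change _ ≤ orbitMeasure f (N k) (x k) _
    rw [orbitMeasure_apply _ _ _ (hclosed k).measurableSet, mul_comm, ← div_eq_mul_inv,
      ENNReal.le_div_iff_mul_le (by simp) (by simp), ← ENNReal.ofReal_natCast,
      ← ENNReal.ofReal_natCast, ← ENNReal.ofReal_mul hε.le]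
    exact ENNReal.ofReal_le_ofReal (hx k).le
  have hanti : Antitone fun L => (⋃ l < L, U l)ᶜ := fun L k hk =>
    compl_subset_compl.2 (biUnion_subset_biUnion_left fun l hl => lt_of_lt_of_le hl hk)
  have h1 := tendsto_measure_iInter_atTop (μ := (μ : Measure X))
    (fun L => (hclosed L).measurableSet.nullMeasurableSet) hanti ⟨0, measure_ne_top _ _⟩
  have h2 : (⋂ L, (⋃ l < L, U l)ᶜ) = (⋃ l, U l)ᶜ := by
    rw [← compl_iUnion]
    congr 1
    ext y
    simp only [mem_iUnion]
    exact ⟨fun ⟨_, l, _, h⟩ => ⟨l, h⟩, fun ⟨l, h⟩ => ⟨l + 1, l, l.lt_succ_self, h⟩⟩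
  have h3 : (μ : Measure X) (⋃ l, U l)ᶜ = 0 := hfull μ inferInstance hinv
  rw [h2, h3] at h1
  have h4 := ge_of_tendsto' h1 hge
  simp only [nonpos_iff_eq_zero, ENNReal.ofReal_eq_zero] at h4
  linarith

end

lemma coverEntropyEntourage_le_of_coverable {X : Type*} [MetricSpace X] [Nonempty X] {f : X → X} {δ γ : ℝ}
    (h : ∀ᶠ N : ℕ in atTop, ∃ c : ℕ, (c : ℝ) ≤ Real.exp (γ * N) ∧ Coverable f δ univ N c) :
    Dynamics.coverEntropyEntourage f univ {p : X × X | dist p.1 p.2 < δ} ≤ (γ : EReal) := by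
  classical
  refine Eventually.expGrowthSup_le (h.mono fun N hN => ?_)
  obtain ⟨c, hc, code, h1, h2⟩ := hN
  have hcov : Dynamics.IsDynCoverOf f univ {p : X × X | dist p.1 p.2 < δ} N
      ((Finset.range c).image (Function.invFun code) : Finset X) := fun x _ => by
    refine ⟨Function.invFun code (code x), ?_, Dynamics.mem_dynEntourage.2 fun i hi => ?_⟩
    · rw [Finset.coe_image]
      exact mem_image_of_mem _ (Finset.mem_coe.2 (Finset.mem_range.2 (h1 x (mem_univ x))))
    · exact h2 x (mem_univ x) _ (mem_univ _) (Function.invFun_eq ⟨x, rfl⟩).symm i hi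
  have hcard : Dynamics.coverMincard f univ {p : X × X | dist p.1 p.2 < δ} N ≤ (c : ℕ∞) :=
    hcov.coverMincard_le_card.trans
      (by exact_mod_cast Finset.card_image_le.trans (Finset.card_range c).le)
  have hexp : EReal.exp ((γ : EReal) * (N : EReal)) = ENNReal.ofReal (Real.exp (γ * N)) := by
    rw [← EReal.exp_coe, EReal.coe_mul]
    rfl
  rw [hexp]
  calc ((Dynamics.coverMincard f univ {p : X × X | dist p.1 p.2 < δ} N : ℕ∞) : ENNReal)
      ≤ ((c : ℕ∞) : ENNReal) := ENat.toENNReal_le.2 hcard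
    _ = ENNReal.ofReal c := by simp
    _ ≤ _ := ENNReal.ofReal_le_ofReal hc

/-- A flow on a compact space whose totally recurrent points are all periodic has zero entropy. -/
theorem coverEntropy_eq_zero_of_exists_period {X : Type*} [MetricSpace X] [CompactSpace X]
    [Nonempty X] (φ : Flow ℝ X)
    (hper : ∀ x, IsTotallyRecurrent φ x → ∃ T > 0, φ T x = x) :
    Dynamics.coverEntropy (φ 1) univ = 0 := by
  refine le_antisymm ?_ (Dynamics.coverEntropy_nonneg _ univ_nonempty)
  rw [Dynamics.coverEntropy_eq_iSup_basis Metric.uniformity_basis_dist]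
  refine iSup₂_le fun δ hδ => ?_
  refine le_of_forall_gt_imp_ge_of_dense fun a ha => ?_
  obtain ⟨γ, hγ, hγa⟩ := EReal.lt_iff_exists_real_btwn.1 ha
  refine le_trans (coverEntropyEntourage_le_of_coverable ?_) hγa.le
  have hγ0 : 0 < γ := by exact_mod_cast hγ
  borelize X
  choose U T C hUo hUp hT hC hcov using fun l : ℕ =>
    exists_isOpen_coverable φ hδ (half_pos (half_pos hγ0))
      (pow_pos (half_pos one_pos) (l + 2) : (0 : ℝ) < (1 / 2) ^ (l + 2)) l
  obtain ⟨S, code, hS, hcode⟩ := exists_code_dist_lt (X := X) hδ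
  have hS0 : 0 < S := (Nat.zero_le _).trans_lt (hS (Classical.arbitrary X))
  have hS1 : Coverable (φ 1) δ univ 1 S := ⟨code, fun x _ => hS x, fun x _ y _ hxy i hi => by
    obtain rfl : i = 0 := by omega
    exact hcode x y hxy⟩
  have hS' : (1 : ℝ) ≤ S := by exact_mod_cast hS0
  have hlog : 0 < Real.log (2 * S) := Real.log_pos (by linarith)
  obtain ⟨L, N₀, hN₀⟩ := exists_forall_ncard_le
    (φ.continuous continuous_const continuous_id : Continuous (φ 1)) hUo
    (fun μ _ hμ => (ae_isTotallyRecurrent φ hμ).mono fun x hx => by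
      obtain ⟨p, hp, hpx⟩ := hper x hx
      obtain ⟨l, hl⟩ := φ.exists_mem_boundedPeriod hp hpx
      exact mem_iUnion.2 ⟨l, hUp l hl⟩)
    (div_pos (half_pos hγ0) hlog)
  obtain ⟨M, hM⟩ : ∃ M : ℕ, ∀ l < L, T l ≤ M :=
    ⟨(Finset.range L).sup T, fun l hl => Finset.le_sup (Finset.mem_range.2 hl)⟩
  filter_upwards [eventually_ge_atTop (max N₀ M)] with N hN
  obtain ⟨c, hc, hcovc⟩ := coverable_fewMisses (half_pos (half_pos hγ0)).le hS0 hT hM hcov hC hS1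
    N ⌊γ / 2 / Real.log (2 * S) * N⌋₊
  refine ⟨c, hc.trans ?_, hcovc.mono (fun x _ => ?_) le_rfl⟩
  · have h1 : ((2 * S : ℝ)) ^ ⌊γ / 2 / Real.log (2 * S) * N⌋₊ ≤ Real.exp (γ / 2 * N) := by
      rw [← Real.rpow_natCast, Real.rpow_def_of_pos (by linarith)]
      refine Real.exp_le_exp.2 ?_
      have := Nat.floor_le (show 0 ≤ γ / 2 / Real.log (2 * S) * N by positivity)
      calc Real.log (2 * S) * ⌊γ / 2 / Real.log (2 * S) * N⌋₊
          ≤ Real.log (2 * S) * (γ / 2 / Real.log (2 * S) * N) := by gcongr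
        _ = γ / 2 * N := by field_simp
    have hMN : (M : ℝ) ≤ N := by exact_mod_cast (le_max_right _ _).trans hN
    calc Real.exp (γ / 2 / 2 * (N + M)) * (2 * S) ^ ⌊γ / 2 / Real.log (2 * S) * N⌋₊
        ≤ Real.exp (γ / 2 / 2 * (N + N)) * Real.exp (γ / 2 * N) := by gcongr
      _ = Real.exp (γ * N) := by
          rw [← Real.exp_add]
          congr 1
          ring
  · exact Nat.le_floor (hN₀ N ((le_max_left _ _).trans hN) x)

theorem stmt2 (Φ : ℝ → Euc 3 → Euc 3) (Cp Γ : Set (Euc 3))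
    (hΦ : IsFlow Φ) (hC : IsConeOrder Cp) (hcomp : StronglyCompetitive Φ Cp)
    (hΓ : Dissipative Φ Γ) :
    Dynamics.coverEntropy (Φ 1) Γ = 0 := by
  obtain ⟨hne, hcpt, hinv, -⟩ := hΓ
  have hmaps : ∀ t, MapsTo (Φ t) Γ Γ := fun t => mapsTo_iff_image_subset.2 (hinv t).subset
  have : CompactSpace Γ := isCompact_iff_compactSpace.1 hcpt
  have : Nonempty Γ := hne.to_subtype
  rw [← Dynamics.coverEntropy_restrict (hmaps 1)]
  refine coverEntropy_eq_zero_of_exists_period (hΦ.toFlow.restrict hmaps) fun x hx => ?_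
  obtain ⟨T, hT, hTx⟩ := hcomp.exists_period hΦ hC (x := x) fun n hn W hW =>
    hx n hn _ (continuous_subtype_val.continuousAt hW)
  exact ⟨T, hT, Subtype.ext hTx⟩
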